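/- There exists a universal constant C > 0 such that for every n, every isotropic log-concave random vector X in ℝⁿ, every p ≥ 1, and every t ≥ C·log(n/σ_X(p)²), one has E[(∑_{i=1}^n X_i² 𝟙{|X_i| ≥ t})^p] ≤ (C·σ_X(p))^{2p}. -/

import Mathlib

open MeasureTheory ProbabilityTheory Real
open scoped Pointwise ENNReal RealInnerProductSpace

noncomputable section

variable {Ω : Type*} [MeasurableSpace Ω]

/-- A random vector `X` in `ℝⁿ` is log-concave: for all nonempty compact sets `K, L` and
`a ∈ [0,1]`, `P(X ∈ aK + (1-a)L) ≥ P(X ∈ K)^a * P(X ∈ L)^(1-a)`. -/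
def IsLogConcave {n : ℕ} (μ : Measure Ω) (X : Ω → EuclideanSpace ℝ (Fin n)) : Prop :=
  ∀ K L : Set (EuclideanSpace ℝ (Fin n)), K.Nonempty → L.Nonempty →
    IsCompact K → IsCompact L → ∀ a : ℝ, 0 ≤ a → a ≤ 1 →
      (μ (X ⁻¹' K)).toReal ^ a * (μ (X ⁻¹' L)).toReal ^ (1 - a) ≤
        (μ (X ⁻¹' (a • K + (1 - a) • L))).toReal

/-- `X` is isotropic: centered with identity covariance matrix. -/
def IsIsotropic {n : ℕ} (μ : Measure Ω) (X : Ω → EuclideanSpace ℝ (Fin n)) : Prop :=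
  (∀ i, ∫ ω, X ω i ∂μ = 0) ∧
  ∀ i j, ∫ ω, X ω i * X ω j ∂μ = if i = j then (1 : ℝ) else 0

/-- `σ_X(p) = sup_{|t| = 1} (E|⟨t,X⟩|^p)^(1/p)`. -/
def sigmaX {n : ℕ} (μ : Measure Ω) (X : Ω → EuclideanSpace ℝ (Fin n)) (p : ℝ) : ℝ :=
  ⨆ t : {t : EuclideanSpace ℝ (Fin n) // ‖t‖ = 1},
    (∫ ω, |⟪t.1, X ω⟫| ^ p ∂μ) ^ (1 / p)

/-- Generalized inverse of `σ_X`. -/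
def sigmaXInv {n : ℕ} (μ : Measure Ω) (X : Ω → EuclideanSpace ℝ (Fin n)) (s : ℝ) : ℝ :=
  sSup {p : ℝ | 1 ≤ p ∧ sigmaX μ X p ≤ s}

set_option linter.unusedSectionVars false

/-- Log-concavity of a measure, tested on measurable sets. -/
def LogConcaveMeasure {E : Type*} [AddCommGroup E] [Module ℝ E] [MeasurableSpace E]
    (ν : Measure E) : Prop :=
  ∀ A B D : Set E, MeasurableSet A → MeasurableSet B → MeasurableSet D →
    ∀ a : ℝ, 0 < a → a < 1 → (∀ x ∈ A, ∀ y ∈ B, a • x + (1 - a) • y ∈ D) →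
      ν.real A ^ a * ν.real B ^ (1 - a) ≤ ν.real D

theorem IsLogConcave.logConcaveMeasure_map {n : ℕ} {μ : Measure Ω} [IsProbabilityMeasure μ]
    {X : Ω → EuclideanSpace ℝ (Fin n)} (hX : Measurable X) (h : IsLogConcave μ X) :
    LogConcaveMeasure (μ.map X) := by
  have : IsProbabilityMeasure (μ.map X) := Measure.isProbabilityMeasure_map hX.aemeasurable
  intro A B D hA hB hD a ha0 ha1 hABD
  set ν := μ.map X with hν
  by_contra hcon
  push Not at hcon
  have key : ∀ K L, K ⊆ A → L ⊆ B → IsCompact K → IsCompact L →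
      ν.real K ^ a * ν.real L ^ (1 - a) ≤ ν.real D := by
    intro K L hKA hLB hK hL
    rcases K.eq_empty_or_nonempty with rfl | hKn
    · simp [Real.zero_rpow ha0.ne', measureReal_nonneg]
    rcases L.eq_empty_or_nonempty with rfl | hLn
    · simp [Real.zero_rpow (sub_pos.2 ha1).ne', measureReal_nonneg]
    have := h K L hKn hLn hK hL a ha0.le ha1.le
    rw [measureReal_def, measureReal_def, hν, Measure.map_apply hX hK.measurableSet,
      Measure.map_apply hX hL.measurableSet]
    refine this.trans ?_
    rw [measureReal_def, Measure.map_apply hX hD]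
    refine ENNReal.toReal_mono (measure_ne_top _ _) (measure_mono (Set.preimage_mono ?_))
    rintro _ ⟨_, ⟨x, hx, rfl⟩, _, ⟨y, hy, rfl⟩, rfl⟩
    exact hABD x (hKA hx) y (hLB hy)
  have hcont : Continuous fun q : ℝ × ℝ => q.1 ^ a * q.2 ^ (1 - a) :=
    (continuous_fst.rpow_const fun _ => Or.inr ha0.le).mul
      (continuous_snd.rpow_const fun _ => Or.inr (sub_pos.2 ha1).le)
  have hseq : ∀ S : Set (EuclideanSpace ℝ (Fin n)), MeasurableSet S →
      ∃ K : ℕ → Set (EuclideanSpace ℝ (Fin n)), (∀ k, K k ⊆ S ∧ IsCompact (K k)) ∧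
        Filter.Tendsto (fun k => ν.real (K k)) Filter.atTop (nhds (ν.real S)) := by
    intro S hS
    have : ∀ k : ℕ, ∃ K ⊆ S, IsCompact K ∧ ν.real S - 1 / ((k : ℝ) + 1) ≤ ν.real K := by
      intro k
      obtain ⟨K, hKS, hK, hlt⟩ := hS.exists_isCompact_lt_add (measure_ne_top ν S)
        (ε := ENNReal.ofReal (1 / ((k : ℝ) + 1))) (by simp; positivity)
      refine ⟨K, hKS, hK, ?_⟩
      have h2 := ENNReal.toReal_mono (by finiteness) hlt.le
      rw [ENNReal.toReal_add (by finiteness) (by finiteness),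
        ENNReal.toReal_ofReal (by positivity)] at h2
      simp only [measureReal_def]; linarith
    choose K hK1 hK2 hK3 using this
    refine ⟨K, fun k => ⟨hK1 k, hK2 k⟩, ?_⟩
    refine tendsto_of_tendsto_of_tendsto_of_le_of_le ?_ tendsto_const_nhds hK3
      (fun k => measureReal_mono (hK1 k))
    simpa using (tendsto_const_nhds (x := ν.real S)).sub
      (tendsto_one_div_add_atTop_nhds_zero_nat (𝕜 := ℝ))
  obtain ⟨K, hK, hKt⟩ := hseq A hA
  obtain ⟨L, hL, hLt⟩ := hseq B hB
  have hlim := (hcont.tendsto (ν.real A, ν.real B)).comp (hKt.prodMk_nhds hLt)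
  have := le_of_tendsto' hlim fun k => key (K k) (L k) (hK k).1 (hL k).1 (hK k).2 (hL k).2
  simp only at this
  linarith

section LogConcave

variable {E F : Type*} [NormedAddCommGroup E] [InnerProductSpace ℝ E] [MeasurableSpace E]
  [BorelSpace E] [FiniteDimensional ℝ E]
  [NormedAddCommGroup F] [InnerProductSpace ℝ F] [MeasurableSpace F] [BorelSpace F]
  [FiniteDimensional ℝ F]

theorem LogConcaveMeasure.map {ν : Measure E} (h : LogConcaveMeasure ν) (f : E →L[ℝ] F) :
    LogConcaveMeasure (ν.map f) := by
  have hf : Measurable f := f.continuous.measurable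
  intro A B D hA hB hD a ha0 ha1 hABD
  simp only [map_measureReal_apply hf, hA, hB, hD]
  refine h _ _ _ (hf hA) (hf hB) (hf hD) a ha0 ha1 fun x hx y hy => ?_
  simpa using hABD _ hx _ hy

theorem real_cond {ν : Measure E} {K A : Set E} (hK : MeasurableSet K) :
    (ν[|K]).real A = ν.real (K ∩ A) / ν.real K := by
  rw [measureReal_def, cond_apply hK, ENNReal.toReal_mul, ENNReal.toReal_inv,
    measureReal_def, measureReal_def, div_eq_inv_mul]

theorem LogConcaveMeasure.cond {ν : Measure E} [IsFiniteMeasure ν] (h : LogConcaveMeasure ν)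
    {K : Set E} (hK : MeasurableSet K) (hc : Convex ℝ K) (h0 : ν K ≠ 0) :
    LogConcaveMeasure (ν[|K]) := by
  intro A B D hA hB hD a ha0 ha1 hABD
  have hpos : 0 < ν.real K := ENNReal.toReal_pos h0 (measure_ne_top _ _)
  simp only [real_cond hK]
  rw [Real.div_rpow measureReal_nonneg measureReal_nonneg,
    Real.div_rpow measureReal_nonneg measureReal_nonneg, div_mul_div_comm,
    ← Real.rpow_add hpos, add_sub_cancel, Real.rpow_one]
  gcongr
  refine h _ _ _ (hK.inter hA) (hK.inter hB) (hK.inter hD) a ha0 ha1 fun x hx y hy => ?_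
  exact ⟨hc hx.1 hy.1 ha0.le (sub_nonneg.2 ha1.le) (by ring), hABD x hx.2 y hy.2⟩

/-- **Borell's lemma** for a linear functional of a log-concave measure. -/
theorem LogConcaveMeasure.tail_le {ν : Measure E} [IsProbabilityMeasure ν]
    (h : LogConcaveMeasure ν) (φ : E →L[ℝ] ℝ) {a κ : ℝ} (ha : 0 < a) (hκ : 1 ≤ κ)
    (htail : ν.real {x | a ≤ |φ x|} ≤ exp (-3 * κ)) {s : ℝ} (hs : 1 ≤ s) :
    ν.real {x | s * a ≤ |φ x|} ≤ exp (-κ * s) := by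
  rcases hs.eq_or_lt with rfl | hs
  · refine (le_trans (by simp) htail).trans (exp_le_exp.2 (by linarith))
  have hφ : Measurable φ := φ.continuous.measurable
  have hm : ∀ c : ℝ, MeasurableSet {x | c ≤ |φ x|} := fun c =>
    measurableSet_le measurable_const (continuous_abs.measurable.comp hφ)
  set lam : ℝ := 2 / (s + 1) with hlam
  have h0 : 0 < lam := by positivity
  have h1 : lam < 1 := by rw [hlam, div_lt_one (by linarith)]; linarith
  have key := h {x | s * a ≤ |φ x|} {x | a ≤ |φ x|}ᶜ {x | a ≤ |φ x|} (hm _) (hm _).compl (hm _)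
    lam h0 h1 ?_
  swap
  · intro x hx y hy
    simp only [Set.mem_ofPred_eq, Set.mem_compl_iff, not_le, map_add, map_smul, smul_eq_mul] at *
    have e : lam * (s * a) - (1 - lam) * a = a := by rw [hlam]; field_simp; ring
    have h2 := abs_sub_abs_le_abs_sub (lam * φ x) (-((1 - lam) * φ y))
    rw [sub_neg_eq_add, abs_neg, abs_mul, abs_mul, abs_of_pos h0,
      abs_of_pos (sub_pos.2 h1)] at h2
    have h3 := mul_le_mul_of_nonneg_left hx h0.le
    have h4 := mul_le_mul_of_nonneg_left hy.le (sub_pos.2 h1).le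
    linarith
  set P := ν.real {x | s * a ≤ |φ x|} with hP
  have hPn : 0 ≤ P := measureReal_nonneg
  have hexp3 : exp (-3 * κ) ≤ exp (-1) := exp_le_exp.2 (by linarith)
  have he1 : exp (-1 : ℝ) < 1 / 2 := by
    have := Real.exp_neg_one_lt_d9; linarith
  have hcompl : exp (-κ) ≤ ν.real {x | a ≤ |φ x|}ᶜ := by
    rw [probReal_compl_eq_one_sub (hm _)]
    have : exp (-κ) ≤ exp (-1) := exp_le_exp.2 (by linarith)
    linarith
  have h5 : P ^ lam * exp (-κ) ^ (1 - lam) ≤ exp (-3 * κ) := by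
    refine le_trans ?_ (key.trans htail)
    gcongr
  rw [← Real.exp_mul] at h5
  have h6 : P ^ lam ≤ exp (-3 * κ + κ * (1 - lam)) := by
    rw [Real.exp_add]
    have : 0 < exp (-κ * (1 - lam)) := exp_pos _
    rw [← le_div_iff₀ this] at h5
    rw [show κ * (1 - lam) = -(-κ * (1 - lam)) by ring, Real.exp_neg (-κ * (1 - lam))]
    simpa [div_eq_mul_inv] using h5
  have h7 : P = (P ^ lam) ^ (lam⁻¹) := by
    rw [← Real.rpow_mul hPn, mul_inv_cancel₀ h0.ne', Real.rpow_one]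
  rw [h7]
  calc (P ^ lam) ^ (lam⁻¹) ≤ (exp (-3 * κ + κ * (1 - lam))) ^ (lam⁻¹) := by gcongr
    _ = exp ((-3 * κ + κ * (1 - lam)) * lam⁻¹) := by rw [← Real.exp_mul]
    _ ≤ exp (-κ * s) := by
      refine exp_le_exp.2 ?_
      rw [← div_eq_mul_inv, div_le_iff₀ h0]
      rw [hlam]
      have : 0 < s + 1 := by linarith
      rw [← sub_nonneg]
      have e : -κ * s * (2 / (s + 1)) - (-3 * κ + κ * (1 - 2 / (s + 1))) =
          2 * κ * (2 / (s + 1)) := by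
        field_simp; ring
      rw [e]; positivity

theorem lintegral_exp_le_of_tail {ν : Measure E} [IsProbabilityMeasure ν] {g : E → ℝ}
    (hg : Measurable g) (hg0 : ∀ x, 0 ≤ g x) {κ : ℝ} (hκ : 1 ≤ κ)
    (htail : ∀ s : ℝ, 1 ≤ s → ν.real {x | s ≤ g x} ≤ exp (-κ * s)) :
    ∫⁻ x, ENNReal.ofReal (exp (κ * g x / 2)) ∂ν ≤ ENNReal.ofReal (3 * exp (κ / 2)) := by
  have hms : ∀ k : ℕ, MeasurableSet {x | (k : ℝ) ≤ g x} := fun k =>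
    measurableSet_le measurable_const hg
  have hpt : ∀ x, ENNReal.ofReal (exp (κ * g x / 2)) ≤
      ∑' k : ℕ, ENNReal.ofReal (exp (κ * (k + 1) / 2)) * {x | (k : ℝ) ≤ g x}.indicator 1 x := by
    intro x
    refine le_trans ?_ (ENNReal.le_tsum ⌊g x⌋₊)
    have : x ∈ {x | ((⌊g x⌋₊ : ℕ) : ℝ) ≤ g x} := Nat.floor_le (hg0 x)
    rw [Set.indicator_of_mem (show x ∈ {y | ((⌊g x⌋₊ : ℕ) : ℝ) ≤ g y} from this)]
    simp only [Pi.one_apply, mul_one]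
    gcongr
    exact (Nat.lt_floor_add_one (g x)).le
  refine (lintegral_mono hpt).trans ?_
  rw [lintegral_tsum (fun k => ((measurable_one.indicator (hms k)).const_mul _).aemeasurable)]
  have hterm : ∀ k : ℕ, ∫⁻ x, ENNReal.ofReal (exp (κ * (k + 1) / 2)) *
      {x | (k : ℝ) ≤ g x}.indicator 1 x ∂ν ≤
      ENNReal.ofReal (exp (κ / 2) * exp (-1 / 2) ^ k) := by
    intro k
    rw [lintegral_const_mul _ (measurable_one.indicator (hms k)), lintegral_indicator_one (hms k),
      ← ofReal_measureReal, ← ENNReal.ofReal_mul (exp_pos _).le, ← Real.exp_nat_mul]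
    apply ENNReal.ofReal_le_ofReal
    rcases Nat.eq_zero_or_pos k with rfl | hk
    · have : ν.real {x | ((0 : ℕ) : ℝ) ≤ g x} ≤ 1 := measureReal_le_one
      simp only [Nat.cast_zero, zero_add, mul_one, zero_mul, exp_zero]
      calc _ ≤ exp (κ / 2) * 1 := by gcongr; simp
        _ = _ := by ring
    · have hk1 : (1 : ℝ) ≤ k := by exact_mod_cast hk
      calc _ ≤ exp (κ * (k + 1) / 2) * exp (-κ * k) := by gcongr; exact htail k hk1
        _ = exp (κ / 2 + (-(κ * k) / 2)) := by rw [← Real.exp_add]; ring_nf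
        _ ≤ exp (κ / 2 + k * (-1 / 2)) := by
          refine exp_le_exp.2 ?_
          nlinarith
        _ = _ := by rw [Real.exp_add]
  refine (ENNReal.tsum_le_tsum hterm).trans ?_
  have hr : exp (-1 / 2 : ℝ) ≤ 2 / 3 := by
    have h1 : exp (-1 / 2 : ℝ) ^ 2 = exp (-1) := by rw [← Real.exp_nat_mul]; norm_num
    have h2 := Real.exp_neg_one_lt_d9
    have h3 := exp_pos (-1 / 2 : ℝ)
    nlinarith
  have hr1 : exp (-1 / 2 : ℝ) < 1 := by linarith
  rw [← ENNReal.ofReal_tsum_of_nonneg (fun k => by positivity)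
    ((summable_geometric_of_lt_one (exp_pos _).le hr1).mul_left _), tsum_mul_left,
    tsum_geometric_of_lt_one (exp_pos _).le hr1]
  apply ENNReal.ofReal_le_ofReal
  rw [mul_comm]
  gcongr
  rw [inv_le_comm₀ (by linarith) (by norm_num)]
  linarith

theorem rpow_le_mul_exp {q x : ℝ} (hq : 0 < q) (hx : 0 ≤ x) :
    x ^ q ≤ (q ^ q * exp (-q)) * exp x := by
  have h1 : x / q ≤ exp (x / q - 1) := by
    have := Real.add_one_le_exp (x / q - 1); linarith
  have h2 : (x / q) ^ q ≤ exp (x / q - 1) ^ q := by gcongr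
  rw [Real.div_rpow hx hq.le, ← Real.exp_mul, div_le_iff₀ (by positivity)] at h2
  refine h2.trans (le_of_eq ?_)
  rw [show (x / q - 1) * q = -q + x by field_simp; ring, Real.exp_add]; ring

theorem LogConcaveMeasure.lintegral_rpow_le {ν : Measure E} [IsProbabilityMeasure ν]
    (h : LogConcaveMeasure ν) (φ : E →L[ℝ] ℝ) {a κ q : ℝ} (ha : 0 < a) (hκ : 1 ≤ κ) (hq : κ ≤ q)
    (htail : ν.real {x | a ≤ |φ x|} ≤ exp (-3 * κ)) :
    ∫⁻ x, ENNReal.ofReal (|φ x| ^ q) ∂ν ≤ ENNReal.ofReal ((6 * a * q / κ) ^ q) := by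
  have hg : Measurable fun x => |φ x| / a :=
    (continuous_abs.measurable.comp φ.continuous.measurable).div_const _
  have hexp := lintegral_exp_le_of_tail hg (fun x => by positivity) hκ (ν := ν) (fun s hs => by
    convert h.tail_le φ ha hκ htail hs using 4 with x
    rw [le_div_iff₀ ha])
  have hq0 : 0 < q := by linarith
  have hpt : ∀ x, ENNReal.ofReal (|φ x| ^ q) ≤
      ENNReal.ofReal ((2 * a * q / κ) ^ q * exp (-q)) *
        ENNReal.ofReal (exp (κ * (|φ x| / a) / 2)) := by
    intro x
    rw [← ENNReal.ofReal_mul (by positivity)]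
    apply ENNReal.ofReal_le_ofReal
    have := rpow_le_mul_exp (x := κ * (|φ x| / a) / 2) hq0 (by positivity)
    have e : |φ x| = (2 * a / κ) * (κ * (|φ x| / a) / 2) := by
      field_simp
    calc |φ x| ^ q = (2 * a / κ) ^ q * (κ * (|φ x| / a) / 2) ^ q := by
          rw [← Real.mul_rpow (by positivity) (by positivity), ← e]
      _ ≤ (2 * a / κ) ^ q * ((q ^ q * exp (-q)) * exp (κ * (|φ x| / a) / 2)) := by gcongr
      _ = _ := by
        rw [show 2 * a * q / κ = (2 * a / κ) * q by ring, Real.mul_rpow (by positivity) hq0.le]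
        ring
  refine (lintegral_mono hpt).trans ?_
  rw [lintegral_const_mul']
  swap; · exact ENNReal.ofReal_ne_top
  refine (mul_le_mul_right hexp _).trans ?_
  rw [← ENNReal.ofReal_mul (by positivity)]
  apply ENNReal.ofReal_le_ofReal
  rw [show 6 * a * q / κ = 3 * (2 * a * q / κ) by ring,
    Real.mul_rpow (by norm_num) (by positivity)]
  have h3 : (3 : ℝ) ≤ 3 ^ q := by
    calc (3 : ℝ) = 3 ^ (1 : ℝ) := by simp
      _ ≤ 3 ^ q := Real.rpow_le_rpow_of_exponent_le (by norm_num) (by linarith)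
  have h4 : exp (-q) * exp (κ / 2) ≤ 1 := by
    rw [← Real.exp_add]; exact Real.exp_le_one_iff.2 (by linarith)
  calc (2 * a * q / κ) ^ q * exp (-q) * (3 * exp (κ / 2))
      = (2 * a * q / κ) ^ q * 3 * (exp (-q) * exp (κ / 2)) := by ring
    _ ≤ (2 * a * q / κ) ^ q * 3 * 1 := by gcongr
    _ ≤ 3 ^ q * (2 * a * q / κ) ^ q := by
      rw [mul_one, mul_comm]; gcongr

theorem LogConcaveMeasure.exists_tail {ν : Measure E} [IsProbabilityMeasure ν]
    (φ : E →L[ℝ] ℝ) {ε : ℝ} (hε : 0 < ε) :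
    ∃ a : ℝ, 0 < a ∧ ν.real {x | a ≤ |φ x|} ≤ ε := by
  have hm : ∀ c : ℝ, MeasurableSet {x | c ≤ |φ x|} := fun c =>
    measurableSet_le measurable_const (continuous_abs.measurable.comp φ.continuous.measurable)
  have hanti : Antitone fun k : ℕ => {x | (k : ℝ) ≤ |φ x|} := by
    intro i j hij x hx
    have hij' : (i : ℝ) ≤ j := by exact_mod_cast hij
    exact hij'.trans hx
  have ht := tendsto_measure_iInter_atTop (μ := ν) (fun k : ℕ => (hm k).nullMeasurableSet) hanti
    ⟨0, measure_ne_top _ _⟩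
  have he : ⋂ k : ℕ, {x | (k : ℝ) ≤ |φ x|} = ∅ := by
    ext x
    simp only [Set.mem_iInter, Set.mem_ofPred_eq, Set.mem_empty_iff_false, iff_false, not_forall,
      not_le]
    exact exists_nat_gt _
  rw [he, measure_empty] at ht
  have h2 := (ht.eventually (gt_mem_nhds (ENNReal.ofReal_pos.2 hε))).and
    (Filter.eventually_ge_atTop 1)
  obtain ⟨k, hk, hk1⟩ := h2.exists
  refine ⟨k, by exact_mod_cast hk1, ?_⟩
  exact ENNReal.toReal_le_of_le_ofReal hε.le hk.le

theorem LogConcaveMeasure.lintegral_rpow_lt_top {ν : Measure E} [IsProbabilityMeasure ν]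
    (h : LogConcaveMeasure ν) (φ : E →L[ℝ] ℝ) {q : ℝ} (hq : 1 ≤ q) :
    ∫⁻ x, ENNReal.ofReal (|φ x| ^ q) ∂ν < ∞ := by
  obtain ⟨a, ha, hta⟩ := LogConcaveMeasure.exists_tail (ν := ν) φ (exp_pos (-3 * 1))
  exact (h.lintegral_rpow_le φ ha le_rfl hq hta).trans_lt ENNReal.ofReal_lt_top

/-- All linear functionals of a log-concave probability measure have all moments. -/
theorem LogConcaveMeasure.integrable_rpow {ν : Measure E} [IsProbabilityMeasure ν]
    (h : LogConcaveMeasure ν) (φ : E →L[ℝ] ℝ) {q : ℝ} (hq : 1 ≤ q) :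
    Integrable (fun x => |φ x| ^ q) ν := by
  refine ⟨?_, ?_⟩
  · exact ((continuous_abs.comp φ.continuous).rpow_const
      fun _ => Or.inr (by linarith)).aestronglyMeasurable
  · rw [hasFiniteIntegral_iff_ofReal (Filter.Eventually.of_forall fun x => by positivity)]
    exact h.lintegral_rpow_lt_top φ hq

theorem LogConcaveMeasure.integral_rpow_le {ν : Measure E} [IsProbabilityMeasure ν]
    (h : LogConcaveMeasure ν) (φ : E →L[ℝ] ℝ) {a κ q : ℝ} (ha : 0 < a) (hκ : 1 ≤ κ) (hq : κ ≤ q)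
    (htail : ν.real {x | a ≤ |φ x|} ≤ exp (-3 * κ)) :
    ∫ x, |φ x| ^ q ∂ν ≤ (6 * a * q / κ) ^ q := by
  have hq0 : 0 < q := by linarith
  rw [integral_eq_lintegral_of_nonneg_ae (Filter.Eventually.of_forall fun x => by positivity)
    (h.integrable_rpow φ (hκ.trans hq)).1]
  exact ENNReal.toReal_le_of_le_ofReal (by positivity) (h.lintegral_rpow_le φ ha hκ hq htail)

/-- Moment comparison for linear functionals of a log-concave measure. -/
theorem LogConcaveMeasure.integral_rpow_le_of_integral_rpow_le {ν : Measure E}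
    [IsProbabilityMeasure ν] (h : LogConcaveMeasure ν) (φ : E →L[ℝ] ℝ) {b p q : ℝ} (hb : 0 < b)
    (hp : 1 ≤ p) (hq : p ≤ q) (hmom : ∫ x, |φ x| ^ p ∂ν ≤ b ^ p) :
    ∫ x, |φ x| ^ q ∂ν ≤ (126 * b * q / p) ^ q := by
  have hp0 : 0 < p := by linarith
  have hq0 : 0 < q := by linarith
  have htail : ν.real {x | exp 3 * b ≤ |φ x|} ≤ exp (-3 * p) := by
    have h1 := mul_meas_ge_le_integral_of_nonneg
      (Filter.Eventually.of_forall fun x => by positivity) (h.integrable_rpow φ hp)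
      ((exp 3 * b) ^ p)
    have h2 : {x | exp 3 * b ≤ |φ x|} ⊆ {x | (exp 3 * b) ^ p ≤ |φ x| ^ p} := fun x hx =>
      Real.rpow_le_rpow (by positivity) hx hp0.le
    have h3 := measureReal_mono (μ := ν) h2
    have h4 : (exp 3 * b) ^ p * ν.real {x | exp 3 * b ≤ |φ x|} ≤ b ^ p :=
      (mul_le_mul_of_nonneg_left h3 (by positivity)).trans (h1.trans hmom)
    rw [Real.mul_rpow (exp_pos _).le hb.le, ← Real.exp_mul, mul_assoc,
      mul_comm (b ^ p), ← mul_assoc] at h4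
    have h5 : exp (3 * p) * ν.real {x | exp 3 * b ≤ |φ x|} ≤ 1 :=
      le_of_mul_le_mul_right (by linarith) (show 0 < b ^ p by positivity)
    rw [neg_mul, Real.exp_neg, ← one_div, le_div_iff₀ (exp_pos _), mul_comm]
    exact h5
  refine (h.integral_rpow_le φ (by positivity) hp hq htail).trans ?_
  have he : exp 3 ≤ 21 := by
    have := Real.exp_one_lt_d9
    rw [show (3 : ℝ) = ((3 : ℕ) : ℝ) * 1 by norm_num, Real.exp_nat_mul]
    calc exp 1 ^ 3 ≤ 2.7182818286 ^ 3 := by gcongr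
      _ ≤ 21 := by norm_num
  have hb' : 6 * (exp 3 * b) ≤ 126 * b := by nlinarith
  apply Real.rpow_le_rpow (by positivity) _ hq0.le
  gcongr

end LogConcave

section BallMeasure

variable {m : ℕ}

local notation "ℝ^" m => EuclideanSpace ℝ (Fin m)

theorem LogConcaveMeasure.closedBall {ν : Measure (ℝ^m)} (h : LogConcaveMeasure ν) (ρ : ℝ)
    {a : ℝ} (ha0 : 0 < a) (ha1 : a < 1) (x y : ℝ^m) :
    ν.real (Metric.closedBall x ρ) ^ a * ν.real (Metric.closedBall y ρ) ^ (1 - a) ≤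
      ν.real (Metric.closedBall (a • x + (1 - a) • y) ρ) := by
  refine h _ _ _ measurableSet_closedBall measurableSet_closedBall measurableSet_closedBall a
    ha0 ha1 fun z hz w hw => ?_
  rw [mem_closedBall_iff_norm] at *
  calc ‖a • z + (1 - a) • w - (a • x + (1 - a) • y)‖
      = ‖a • (z - x) + (1 - a) • (w - y)‖ := by
        rw [smul_sub, smul_sub]; congr 1; abel
    _ ≤ ‖a • (z - x)‖ + ‖(1 - a) • (w - y)‖ := norm_add_le _ _
    _ = a * ‖z - x‖ + (1 - a) * ‖w - y‖ := by
        rw [norm_smul, norm_smul, Real.norm_of_nonneg ha0.le,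
          Real.norm_of_nonneg (sub_pos.2 ha1).le]
    _ ≤ a * ρ + (1 - a) * ρ := by
        have := sub_pos.2 ha1
        gcongr
    _ = ρ := by ring

theorem measurable_measure_closedBall (ν : Measure (ℝ^m)) [SFinite ν] (ρ : ℝ) :
    Measurable fun x => ν (Metric.closedBall x ρ) := by
  have hS : MeasurableSet {z : (ℝ^m) × (ℝ^m) | dist z.2 z.1 ≤ ρ} :=
    measurableSet_le (by fun_prop) measurable_const
  exact measurable_measure_prodMk_left hS

theorem setLIntegral_measure_closedBall (ν : Measure (ℝ^m)) [SFinite ν] (ρ : ℝ)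
    {T : Set (ℝ^m)} (hT : MeasurableSet T) :
    ∫⁻ x in T, ν (Metric.closedBall x ρ) =
      ∫⁻ y, volume (Metric.closedBall y ρ ∩ T) ∂ν := by
  have hS : MeasurableSet {z : (ℝ^m) × (ℝ^m) | dist z.2 z.1 ≤ ρ} :=
    measurableSet_le (by fun_prop) measurable_const
  have h1 := Measure.prod_apply (μ := (volume : Measure (ℝ^m)).restrict T) (ν := ν) hS
  have h2 := Measure.prod_apply_symm (μ := (volume : Measure (ℝ^m)).restrict T) (ν := ν) hS
  rw [h1] at h2
  refine h2.trans (lintegral_congr fun y => ?_)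
  rw [← Measure.restrict_apply' hT]
  congr 1
  ext x
  simp [dist_comm]

theorem lintegral_measure_closedBall (ν : Measure (ℝ^m)) [IsProbabilityMeasure ν] (ρ : ℝ) :
    ∫⁻ x, ν (Metric.closedBall x ρ) = volume (Metric.closedBall (0 : ℝ^m) ρ) := by
  have := setLIntegral_measure_closedBall ν ρ MeasurableSet.univ
  simp only [Measure.restrict_univ, Set.inter_univ] at this
  rw [this]
  simp [Measure.addHaar_closedBall_center]

theorem lintegral_smul_comp (f : (ℝ^m) → ℝ≥0∞) (hf : Measurable f) {r : ℝ} (hr : 0 < r) :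
    ∫⁻ x, f x = ENNReal.ofReal (r ^ m) * ∫⁻ x, f (r • x) := by
  have h1 := Measure.map_addHaar_smul (volume : Measure (ℝ^m)) hr.ne'
  have h2 : ∫⁻ x, f x ∂(Measure.map (r • ·) (volume : Measure (ℝ^m))) = ∫⁻ x, f (r • x) :=
    lintegral_map hf (measurable_const_smul r)
  rw [← h2, h1, lintegral_smul_measure, finrank_euclideanSpace, Fintype.card_fin, smul_eq_mul,
    ← mul_assoc, ← ENNReal.ofReal_mul (by positivity), abs_of_pos (by positivity),
    mul_inv_cancel₀ (by positivity), ENNReal.ofReal_one, one_mul]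

/-- If the level set of `x ↦ ν (closedBall x ρ)` misses a half-space, then `ν` puts little mass on
a dilated half-space. -/
theorem LogConcaveMeasure.halfspace_le {ν : Measure (ℝ^m)} [IsProbabilityMeasure ν]
    (h : LogConcaveMeasure ν) {ρ : ℝ} (hρ : 0 < ρ)
    (h0 : 1 / 2 ≤ ν.real (Metric.closedBall 0 ρ)) {u : ℝ^m} (hu : ‖u‖ = 1) {τ : ℝ}
    (hK : ∀ z : ℝ^m, τ ≤ ⟪u, z⟫ → ν.real (Metric.closedBall z ρ) < exp (-(m : ℝ)) / 2) :
    ν.real {y | ρ + 10 * τ ≤ ⟪u, y⟫} ≤ exp (-6 * m) := by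
  set B := volume (Metric.closedBall (0 : ℝ^m) ρ) with hB
  have hB0 : B ≠ 0 := (Metric.measure_closedBall_pos _ _ hρ).ne'
  have hBt : B ≠ ∞ := measure_closedBall_lt_top.ne
  set q : (ℝ^m) → ℝ≥0∞ := fun x => ν (Metric.closedBall x ρ) with hq
  have hqm : Measurable q := measurable_measure_closedBall ν ρ
  have hTm : ∀ c : ℝ, MeasurableSet {x : ℝ^m | c ≤ ⟪u, x⟫} := fun c =>
    measurableSet_le measurable_const (by fun_prop)
  have h1 : B * ν {y | ρ + 10 * τ ≤ ⟪u, y⟫} ≤ ∫⁻ x in {x | 10 * τ ≤ ⟪u, x⟫}, q x := by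
    rw [setLIntegral_measure_closedBall ν ρ (hTm _)]
    calc B * ν {y | ρ + 10 * τ ≤ ⟪u, y⟫}
        = ∫⁻ y in {y | ρ + 10 * τ ≤ ⟪u, y⟫}, B ∂ν := by rw [setLIntegral_const]
      _ ≤ ∫⁻ y in {y | ρ + 10 * τ ≤ ⟪u, y⟫},
          volume (Metric.closedBall y ρ ∩ {x | 10 * τ ≤ ⟪u, x⟫}) ∂ν := by
          refine setLIntegral_mono' (hTm _) fun y hy => ?_
          rw [Set.inter_eq_self_of_subset_left, Measure.addHaar_closedBall_center]
          intro x hx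
          rw [mem_closedBall_iff_norm'] at hx
          have h2 : ⟪u, y - x⟫ ≤ ‖u‖ * ‖y - x‖ := real_inner_le_norm _ _
          rw [inner_sub_right, hu] at h2
          simp only [Set.mem_ofPred_eq] at hy ⊢
          linarith
      _ ≤ _ := setLIntegral_le_lintegral _ _
  have h2 : ∫⁻ x in {x | 10 * τ ≤ ⟪u, x⟫}, q x ≤
      ENNReal.ofReal (10 ^ m) * ∫⁻ z, ENNReal.ofReal (exp (-9 * m)) * q z := by
    rw [← lintegral_indicator (hTm _), lintegral_smul_comp _ (hqm.indicator (hTm _))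
      (show (0 : ℝ) < 10 by norm_num)]
    refine mul_le_mul_right (lintegral_mono fun z => ?_) _
    by_cases hz : τ ≤ ⟪u, z⟫
    swap
    · rw [Set.indicator_of_notMem]
      · exact zero_le
      · simp only [Set.mem_ofPred_eq, inner_smul_right]
        intro h; exact hz (by linarith)
    refine (Set.indicator_le_self _ _ _).trans ?_
    have hzK := hK z hz
    have h3 := h.closedBall ρ (show (0 : ℝ) < 1 / 10 by norm_num) (by norm_num) ((10 : ℝ) • z) 0
    rw [smul_zero, add_zero, smul_smul] at h3
    norm_num at h3
    set x := ν.real (Metric.closedBall ((10 : ℝ) • z) ρ)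
    set w := ν.real (Metric.closedBall z ρ)
    set v := ν.real (Metric.closedBall 0 ρ)
    have hx0 : 0 ≤ x := measureReal_nonneg
    have hw0 : 0 ≤ w := measureReal_nonneg
    have hv0 : 0 ≤ v := measureReal_nonneg
    have h4 : x * v ^ 9 ≤ w ^ 10 := by
      have := pow_le_pow_left₀ (by positivity) h3 10
      rw [mul_pow, ← Real.rpow_natCast, ← Real.rpow_natCast (_ ^ (9 / 10 : ℝ)),
        ← Real.rpow_mul hx0, ← Real.rpow_mul hv0] at this
      norm_num at this
      exact_mod_cast this
    have h5 : x ≤ exp (-9 * m) * w := by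
      have h6 : x * (1 / 2) ^ 9 ≤ (exp (-(m : ℝ)) / 2) ^ 9 * w := by
        calc x * (1 / 2) ^ 9 ≤ x * v ^ 9 := by gcongr
          _ ≤ w ^ 10 := h4
          _ = w ^ 9 * w := by ring
          _ ≤ _ := by gcongr
      rw [div_pow (exp _), ← Real.exp_nat_mul] at h6
      push_cast at h6
      rw [show (9 : ℝ) * -(m : ℝ) = -9 * m by ring] at h6
      have h7 : x * (1 / 2) ^ 9 ≤ (exp (-9 * m) * w) * (1 / 2) ^ 9 := h6.trans_eq (by ring)
      exact le_of_mul_le_mul_right h7 (by norm_num)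
    have e2 : q z = ENNReal.ofReal w := by
      simp only [hq]; rw [ofReal_measureReal]
    calc q ((10 : ℝ) • z) = ENNReal.ofReal x := by simp only [hq]; rw [ofReal_measureReal]
      _ ≤ ENNReal.ofReal (exp (-9 * m) * w) := ENNReal.ofReal_le_ofReal h5
      _ = _ := by rw [ENNReal.ofReal_mul (exp_pos _).le, e2]
  rw [lintegral_const_mul _ hqm, lintegral_measure_closedBall ν ρ, ← mul_assoc,
    ← ENNReal.ofReal_mul (by positivity)] at h2
  have h3 : B * ν {y | ρ + 10 * τ ≤ ⟪u, y⟫} ≤ B * ENNReal.ofReal (exp (-6 * m)) := by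
    refine (h1.trans h2).trans ?_
    rw [mul_comm]
    refine mul_le_mul_right (ENNReal.ofReal_le_ofReal ?_) _
    have h10 : (10 : ℝ) ≤ exp 3 := by
      have := Real.exp_one_gt_d9
      rw [show (3 : ℝ) = ((3 : ℕ) : ℝ) * 1 by norm_num, Real.exp_nat_mul]
      calc (10 : ℝ) ≤ 2.7182818283 ^ 3 := by norm_num
        _ ≤ _ := by gcongr
    calc (10 : ℝ) ^ m * exp (-9 * m) ≤ exp 3 ^ m * exp (-9 * m) := by gcongr
      _ = exp (-6 * m) := by
        rw [← Real.exp_nat_mul, ← Real.exp_add]; congr 1; ring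
  rw [ENNReal.mul_le_mul_iff_right hB0 hBt] at h3
  exact ENNReal.toReal_le_of_le_ofReal (exp_pos _).le h3

/-- Volume bound for the difference body of a level set of `x ↦ ν (closedBall x ρ)`. -/
theorem LogConcaveMeasure.volume_sub_le {ν : Measure (ℝ^m)} [IsProbabilityMeasure ν]
    (h : LogConcaveMeasure ν) {ρ κ : ℝ} (hρ : 0 < ρ) (hκ : 0 ≤ κ) {K : Set (ℝ^m)}
    (hK : ∀ z ∈ K, κ ≤ ν.real (Metric.closedBall z ρ)) :
    ENNReal.ofReal (κ / 4 ^ m) * volume (K - K) ≤ volume (Metric.closedBall (0 : ℝ^m) ρ) := by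
  set B := volume (Metric.closedBall (0 : ℝ^m) ρ) with hB
  have hB0 : B ≠ 0 := (Metric.measure_closedBall_pos _ _ hρ).ne'
  have hBt : B ≠ ∞ := measure_closedBall_lt_top.ne
  set q : (ℝ^m) → ℝ≥0∞ := fun x => ν (Metric.closedBall x ρ) with hq
  have hqm : Measurable q := measurable_measure_closedBall ν ρ
  have hqi : ∫⁻ x, q x = B := lintegral_measure_closedBall ν ρ
  set H : (ℝ^m) → ℝ≥0∞ := fun x => ∫⁻ w, q w * q (w - x) with hH
  have hHm : Measurable H := by
    apply Measurable.lintegral_prod_right'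
      (f := fun z : (ℝ^m) × (ℝ^m) => q z.2 * q (z.2 - z.1))
    exact (hqm.comp measurable_snd).mul (hqm.comp (measurable_snd.sub measurable_fst))
  have hHi : ∫⁻ x, H x = B * B := by
    rw [lintegral_lintegral_swap]
    · calc ∫⁻ w, ∫⁻ x, q w * q (w - x) = ∫⁻ w, q w * B := by
            refine lintegral_congr fun w => ?_
            rw [lintegral_const_mul _ (by fun_prop), lintegral_sub_left_eq_self q w, hqi]
        _ = B * B := by rw [lintegral_mul_const _ hqm, hqi]
    · exact ((hqm.comp measurable_snd).mul
        (hqm.comp (measurable_snd.sub measurable_fst))).aemeasurable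
  have hc : (0 : ℝ) < 1 / 2 := by norm_num
  have hlow : ∀ x ∈ (1 / 2 : ℝ) • (K - K), ENNReal.ofReal (κ / 2 ^ m) * B ≤ H x := by
    rintro _ ⟨_, ⟨a, ha, b, hb, rfl⟩, rfl⟩
    simp only [hH]
    have h1 := lintegral_add_left_eq_self (μ := (volume : Measure (ℝ^m)))
      (fun w => q w * q (w - (1 / 2 : ℝ) • (a - b))) ((1 / 2 : ℝ) • a)
    rw [← h1, lintegral_smul_comp _ (by fun_prop) hc]
    have h2 : ENNReal.ofReal (κ / 2 ^ m) * B =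
        ENNReal.ofReal ((1 / 2) ^ m) * ∫⁻ z, ENNReal.ofReal κ * q z := by
      rw [lintegral_const_mul _ hqm, hqi, ← mul_assoc, ← ENNReal.ofReal_mul (by positivity)]
      congr 2
      rw [one_div, inv_pow]; ring
    rw [h2]
    refine mul_le_mul_right (lintegral_mono fun z => ?_) _
    have e1 : (1 / 2 : ℝ) • a + (1 / 2 : ℝ) • z = (1 / 2 : ℝ) • a + (1 - 1 / 2 : ℝ) • z := by
      norm_num
    have e2 : (1 / 2 : ℝ) • a + (1 / 2 : ℝ) • z - (1 / 2 : ℝ) • (a - b) =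
        (1 / 2 : ℝ) • b + (1 - 1 / 2 : ℝ) • z := by
      rw [show (1 - 1 / 2 : ℝ) = 1 / 2 by norm_num]
      module
    have h3 := h.closedBall ρ hc (by norm_num) a z
    have h4 := h.closedBall ρ hc (by norm_num) b z
    rw [← e1] at h3
    rw [← e2] at h4
    simp only [hq]
    rw [← ofReal_measureReal (μ := ν) (s := Metric.closedBall z ρ),
      ← ofReal_measureReal (μ := ν)
        (s := Metric.closedBall ((1 / 2 : ℝ) • a + (1 / 2 : ℝ) • z) ρ),
      ← ofReal_measureReal (μ := ν) (s := Metric.closedBall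
        ((1 / 2 : ℝ) • a + (1 / 2 : ℝ) • z - (1 / 2 : ℝ) • (a - b)) ρ),
      ← ENNReal.ofReal_mul hκ, ← ENNReal.ofReal_mul measureReal_nonneg]
    refine ENNReal.ofReal_le_ofReal ?_
    refine le_trans ?_ (mul_le_mul h3 h4 (by positivity) measureReal_nonneg)
    have hz : 0 ≤ ν.real (Metric.closedBall z ρ) := measureReal_nonneg
    have hsq : ν.real (Metric.closedBall z ρ) ^ (1 - 1 / 2 : ℝ) *
        ν.real (Metric.closedBall z ρ) ^ (1 - 1 / 2 : ℝ) = ν.real (Metric.closedBall z ρ) := by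
      rw [← Real.rpow_add_of_nonneg hz (by norm_num) (by norm_num)]; norm_num
    have hκsq : κ ^ (1 / 2 : ℝ) * κ ^ (1 / 2 : ℝ) = κ := by
      rw [← Real.rpow_add_of_nonneg hκ (by norm_num) (by norm_num)]; norm_num
    calc κ * ν.real (Metric.closedBall z ρ)
        = (κ ^ (1 / 2 : ℝ) * ν.real (Metric.closedBall z ρ) ^ (1 - 1 / 2 : ℝ)) *
          (κ ^ (1 / 2 : ℝ) * ν.real (Metric.closedBall z ρ) ^ (1 - 1 / 2 : ℝ)) := by
          rw [mul_mul_mul_comm, hsq, hκsq]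
      _ ≤ _ := by
          have := hK a ha
          have := hK b hb
          gcongr
  have hM := mul_meas_ge_le_lintegral (μ := (volume : Measure (ℝ^m))) hHm
    (ENNReal.ofReal (κ / 2 ^ m) * B)
  rw [hHi] at hM
  have h5 : ENNReal.ofReal (κ / 2 ^ m) * B * volume ((1 / 2 : ℝ) • (K - K)) ≤ B * B :=
    (mul_le_mul_right (measure_mono hlow) _).trans hM
  rw [Measure.addHaar_smul, finrank_euclideanSpace, Fintype.card_fin, mul_comm _ B, mul_assoc,
    ENNReal.mul_le_mul_iff_right hB0 hBt, ← mul_assoc, ← ENNReal.ofReal_mul (by positivity)] at h5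
  convert h5 using 3
  rw [abs_of_pos (by positivity), one_div, inv_pow, show (4 : ℝ) = 2 * 2 by norm_num, mul_pow]
  field_simp

/-- A log-concave measure with most of its mass in a ball has a one-dimensional marginal with
small tail. -/
theorem LogConcaveMeasure.exists_direction {ν : Measure (ℝ^m)} [IsProbabilityMeasure ν]
    (h : LogConcaveMeasure ν) (hm : 1 ≤ m) {ρ : ℝ} (hρ : 0 < ρ)
    (h0 : 1 / 2 ≤ ν.real (Metric.closedBall 0 ρ)) :
    ∃ u : ℝ^m, ‖u‖ = 1 ∧ ν.real {y | 241 * ρ ≤ |⟪u, y⟫|} ≤ exp (-3 * m) := by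
  by_contra! hcon
  have hm' : (1 : ℝ) ≤ m := by exact_mod_cast hm
  set κ := exp (-(m : ℝ)) / 2 with hκ
  have hκ0 : 0 < κ := by positivity
  set K := {z : ℝ^m | κ ≤ ν.real (Metric.closedBall z ρ)} with hK
  have hKc : Convex ℝ K := by
    refine convex_iff_forall_pos.2 fun x hx y hy a b ha hb hab => ?_
    obtain rfl : b = 1 - a := by linarith
    have := h.closedBall ρ ha (by linarith) x y
    refine le_trans ?_ this
    calc κ = κ ^ a * κ ^ (1 - a) := by rw [← Real.rpow_add hκ0]; simp
      _ ≤ _ := by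
        have : κ ≤ ν.real (Metric.closedBall x ρ) := hx
        have : κ ≤ ν.real (Metric.closedBall y ρ) := hy
        gcongr
  have h0K : (0 : ℝ^m) ∈ K := by
    refine le_trans ?_ h0
    rw [hκ]
    have : exp (-(m : ℝ)) ≤ 1 := exp_le_one_iff.2 (by linarith)
    linarith
  have hdir : ∀ u : ℝ^m, ‖u‖ = 1 → ∃ d ∈ K - K, 24 * ρ ≤ ⟪u, d⟫ := by
    intro u hu
    by_contra! hd
    have h1 : ∀ v : ℝ^m, ‖v‖ = 1 → (∀ z ∈ K, ⟪v, z⟫ < 24 * ρ) →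
        ν.real {y | 241 * ρ ≤ ⟪v, y⟫} ≤ exp (-6 * m) := by
      intro v hv hvK
      have := h.halfspace_le hρ h0 hv (τ := 24 * ρ) fun z hz => by
        by_contra! hzK
        exact absurd (hvK z hzK) (not_lt.2 hz)
      rwa [show ρ + 10 * (24 * ρ) = 241 * ρ by ring] at this
    have h2 := h1 u hu fun z hz => hd z ⟨z, hz, 0, h0K, sub_zero z⟩
    have h3 := h1 (-u) (by rw [norm_neg, hu]) fun z hz => by
      have := hd (0 - z) ⟨0, h0K, z, hz, rfl⟩
      rwa [zero_sub, inner_neg_right, ← inner_neg_left] at this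
    have h4 : {y : ℝ^m | 241 * ρ ≤ |⟪u, y⟫|} ⊆
        {y | 241 * ρ ≤ ⟪u, y⟫} ∪ {y | 241 * ρ ≤ ⟪-u, y⟫} := by
      intro y hy
      simp only [Set.mem_union, Set.mem_ofPred_eq, inner_neg_left] at hy ⊢
      exact le_abs.1 hy
    have h5 := (measureReal_mono (μ := ν) h4).trans (measureReal_union_le _ _)
    have h6 := hcon u hu
    have h7 : exp (-6 * m) * 2 ≤ exp (-3 * m) := by
      calc exp (-6 * m) * 2 ≤ exp (-6 * m) * exp (3 * m) := by
            gcongr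
            have := Real.add_one_le_exp (3 * (m : ℝ))
            linarith
        _ = exp (-3 * m) := by rw [← Real.exp_add]; congr 1; ring
    linarith
  have hDc : Convex ℝ (K - K) := hKc.sub hKc
  have hball : Metric.closedBall (0 : ℝ^m) (24 * ρ) ⊆ closure (K - K) := by
    intro x hx
    by_contra hxc
    obtain ⟨f, u, hfu, hux⟩ := geometric_hahn_banach_closed_point hDc.closure isClosed_closure hxc
    obtain ⟨v, rfl⟩ := (InnerProductSpace.toDual ℝ (ℝ^m)).surjective f
    simp only [InnerProductSpace.toDual_apply_apply] at hfu hux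
    have hv : v ≠ 0 := by
      rintro rfl
      have := hfu 0 (subset_closure ⟨0, h0K, 0, h0K, sub_zero 0⟩)
      simp only [inner_zero_left] at this hux
      linarith
    have hv0 : 0 < ‖v‖ := norm_pos_iff.2 hv
    obtain ⟨d, hd, hdu⟩ := hdir (‖v‖⁻¹ • v) (by
      rw [norm_smul, norm_inv, norm_norm, inv_mul_cancel₀ hv0.ne'])
    rw [real_inner_smul_left, inv_mul_eq_div, le_div_iff₀ hv0] at hdu
    have h1 := hfu d (subset_closure hd)
    have h2 := real_inner_le_norm v x
    rw [mem_closedBall_zero_iff] at hx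
    nlinarith
  have hvol : volume (Metric.closedBall (0 : ℝ^m) (24 * ρ)) ≤ volume (K - K) := by
    refine (measure_mono hball).trans ?_
    rw [closure_eq_self_union_frontier]
    refine (measure_union_le _ _).trans ?_
    rw [hDc.addHaar_frontier volume, add_zero]
  have h1 := h.volume_sub_le hρ hκ0.le (K := K) fun z hz => hz
  have h2 := (mul_le_mul_right hvol (ENNReal.ofReal (κ / 4 ^ m))).trans h1
  rw [Measure.addHaar_closedBall_mul _ _ (by norm_num) hρ.le, finrank_euclideanSpace,
    Fintype.card_fin, ← mul_assoc, ← ENNReal.ofReal_mul (by positivity)] at h2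
  have hB0 : volume (Metric.closedBall (0 : ℝ^m) ρ) ≠ 0 :=
    (Metric.measure_closedBall_pos _ _ hρ).ne'
  have hBt : volume (Metric.closedBall (0 : ℝ^m) ρ) ≠ ∞ := measure_closedBall_lt_top.ne
  have h3 : ENNReal.ofReal (κ / 4 ^ m * 24 ^ m) ≤ 1 := by
    rw [← ENNReal.mul_le_mul_iff_left hB0 hBt, one_mul]
    exact h2
  rw [ENNReal.ofReal_le_one] at h3
  have h4 : κ / 4 ^ m * 24 ^ m = (6 * exp (-1)) ^ m / 2 := by
    rw [hκ, mul_pow, ← Real.exp_nat_mul, show (24 : ℝ) = 4 * 6 by norm_num, mul_pow,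
      show (m : ℝ) * -1 = -m by ring]
    field_simp
  have h5 : 2 < 6 * exp (-1) := by
    have := Real.exp_neg_one_gt_d9; linarith
  have h6 : 6 * exp (-1) ≤ (6 * exp (-1)) ^ m := le_self_pow₀ (by linarith) (by omega)
  linarith

/-- A log-concave measure with most of its mass in a ball has a one-dimensional marginal with
small moment of order the dimension. -/
theorem LogConcaveMeasure.exists_integral_rpow_le {ν : Measure (ℝ^m)} [IsProbabilityMeasure ν]
    (h : LogConcaveMeasure ν) (hm : 1 ≤ m) {ρ : ℝ} (hρ : 0 < ρ)
    (h0 : 1 / 2 ≤ ν.real (Metric.closedBall 0 ρ)) :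
    ∃ u : ℝ^m, ‖u‖ = 1 ∧ ∫ y, |⟪u, y⟫| ^ (m : ℝ) ∂ν ≤ (1446 * ρ) ^ (m : ℝ) := by
  obtain ⟨u, hu, htail⟩ := h.exists_direction hm hρ h0
  have hm' : (1 : ℝ) ≤ m := by exact_mod_cast hm
  refine ⟨u, hu, ?_⟩
  have := h.integral_rpow_le (innerSL ℝ u) (by positivity) hm' le_rfl htail
  simp only [innerSL_apply_apply] at this
  refine this.trans_eq ?_
  congr 1
  field_simp
  norm_num

end BallMeasure

section GaussianConcentration

variable {E : Type*} [NormedAddCommGroup E] [InnerProductSpace ℝ E] [MeasurableSpace E]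
  [BorelSpace E] [FiniteDimensional ℝ E]

theorem map_stdGaussian_clm (φ : E →L[ℝ] ℝ) :
    (stdGaussian E).map φ = gaussianReal 0 (‖φ‖ ^ 2).toNNReal := by
  rw [IsGaussian.map_eq_gaussianReal, integral_strongDual_stdGaussian, variance_dual_stdGaussian]

theorem lintegral_exp_stdGaussian (φ : E →L[ℝ] ℝ) :
    ∫⁻ x, ENNReal.ofReal (exp (φ x)) ∂(stdGaussian E) = ENNReal.ofReal (exp (‖φ‖ ^ 2 / 2)) := by
  have h1 : ∫⁻ x, ENNReal.ofReal (exp (φ x)) ∂(stdGaussian E) =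
      ∫⁻ y, ENNReal.ofReal (exp y) ∂((stdGaussian E).map φ) := by
    rw [lintegral_map (by fun_prop) (by fun_prop)]
  rw [h1, map_stdGaussian_clm]
  have h2 := integrable_exp_mul_gaussianReal (μ := 0) (v := (‖φ‖ ^ 2).toNNReal) 1
  simp only [one_mul] at h2
  rw [← ofReal_integral_eq_lintegral_ofReal h2 (Filter.Eventually.of_forall fun _ => by positivity)]
  have h3 := congrFun (mgf_id_gaussianReal (μ := 0) (v := (‖φ‖ ^ 2).toNNReal)) 1
  simp only [mgf, id, one_mul] at h3
  rw [h3]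
  congr 2
  rw [Real.coe_toNNReal _ (by positivity)]
  ring

theorem integral_fderiv_rotation {f : E → ℝ} (hf : ContDiff ℝ 1 f) (z : E × E) :
    Continuous (fun θ => fderiv ℝ f (ContinuousLinearMap.rotation θ z).1
      (ContinuousLinearMap.rotation θ z).2) ∧
    ∫ θ in (0 : ℝ)..(π / 2), fderiv ℝ f (ContinuousLinearMap.rotation θ z).1
      (ContinuousLinearMap.rotation θ z).2 = f z.2 - f z.1 := by
  obtain ⟨x, y⟩ := z
  simp only [ContinuousLinearMap.rotation_apply]
  have hdc : Continuous (fderiv ℝ f) := hf.continuous_fderiv (by norm_num)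
  have hDc : Continuous fun θ : ℝ => fderiv ℝ f (cos θ • x + sin θ • y)
      (-sin θ • x + cos θ • y) :=
    (hdc.comp (by fun_prop)).clm_apply (by fun_prop)
  refine ⟨hDc, ?_⟩
  have hderiv : ∀ θ : ℝ, HasDerivAt (fun θ : ℝ => f (cos θ • x + sin θ • y))
      (fderiv ℝ f (cos θ • x + sin θ • y) (-sin θ • x + cos θ • y)) θ := by
    intro θ
    have h1 : HasDerivAt (fun θ : ℝ => cos θ • x + sin θ • y) (-sin θ • x + cos θ • y) θ :=
      ((Real.hasDerivAt_cos θ).smul_const x).add ((Real.hasDerivAt_sin θ).smul_const y)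
    exact ((hf.differentiable (by norm_num)) _).hasFDerivAt.comp_hasDerivAt θ h1
  rw [intervalIntegral.integral_eq_sub_of_hasDerivAt (fun θ _ => hderiv θ)
    (hDc.intervalIntegrable _ _)]
  simp

/-- The Maurey-Pisier exponential inequality for smooth Lipschitz functions of a Gaussian vector. -/
theorem lintegral_exp_sub_stdGaussian_le {f : E → ℝ} (hf : ContDiff ℝ 1 f) {L : ℝ}
    (hL : ∀ x, ‖fderiv ℝ f x‖ ≤ L) :
    ∫⁻ z, ENNReal.ofReal (exp (f z.2 - f z.1)) ∂((stdGaussian E).prod (stdGaussian E)) ≤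
      ENNReal.ofReal (exp (π ^ 2 * L ^ 2 / 8)) := by
  set γ := stdGaussian E
  set g : E × E → ℝ := fun z => exp (π / 2 * fderiv ℝ f z.1 z.2) with hg
  have hdc : Continuous (fderiv ℝ f) := hf.continuous_fderiv (by norm_num)
  have hgc : Continuous g := by
    have : Continuous fun z : E × E => fderiv ℝ f z.1 z.2 :=
      (hdc.comp continuous_fst).clm_apply continuous_snd
    fun_prop
  have hrc : Continuous fun w : (E × E) × ℝ => ContinuousLinearMap.rotation w.2 w.1 := by
    simp only [ContinuousLinearMap.rotation_apply]
    fun_prop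
  set V : Measure ℝ := ENNReal.ofReal (2 / π) • volume.restrict (Set.Ioc 0 (π / 2)) with hV
  have hVp : IsProbabilityMeasure V := ⟨by
    rw [hV, Measure.smul_apply, Measure.restrict_apply_univ, Real.volume_Ioc, smul_eq_mul,
      ← ENNReal.ofReal_mul (by positivity), sub_zero]
    rw [show 2 / π * (π / 2) = 1 by field_simp, ENNReal.ofReal_one]⟩
  have hpt : ∀ z : E × E, ENNReal.ofReal (exp (f z.2 - f z.1)) ≤
      ∫⁻ θ, ENNReal.ofReal (g (ContinuousLinearMap.rotation θ z)) ∂V := by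
    intro z
    obtain ⟨hDc, hftc⟩ := integral_fderiv_rotation hf z
    set D : ℝ → ℝ := fun θ => fderiv ℝ f (ContinuousLinearMap.rotation θ z).1
      (ContinuousLinearMap.rotation θ z).2 with hD
    have hint : ∀ k : ℝ → ℝ, Continuous k → Integrable k V := fun k hk =>
      ((hk.integrableOn_Icc).mono_set Set.Ioc_subset_Icc_self).smul_measure ENNReal.ofReal_ne_top
    have hmean : ∫ θ, π / 2 * D θ ∂V = f z.2 - f z.1 := by
      rw [hV, integral_smul_measure, ENNReal.toReal_ofReal (by positivity), integral_const_mul,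
        ← intervalIntegral.integral_of_le (by positivity), hftc, smul_eq_mul]
      field_simp
    have hJ := convexOn_exp.map_integral_le (μ := V) (f := fun θ => π / 2 * D θ)
      continuous_exp.continuousOn isClosed_univ (by simp) (hint _ (by fun_prop))
      (hint _ (by fun_prop))
    rw [hmean] at hJ
    refine (ENNReal.ofReal_le_ofReal hJ).trans_eq ?_
    rw [ofReal_integral_eq_lintegral_ofReal (hint _ (by fun_prop))
      (Filter.Eventually.of_forall fun _ => (exp_pos _).le)]
  refine (lintegral_mono hpt).trans ?_
  have hrot : ∀ θ : ℝ, ∫⁻ z, ENNReal.ofReal (g (ContinuousLinearMap.rotation θ z)) ∂(γ.prod γ) ≤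
      ENNReal.ofReal (exp (π ^ 2 * L ^ 2 / 8)) := by
    intro θ
    have h0 := IsGaussian.map_rotation_eq_self (μ := γ) (by simp [γ]) θ
    have h1 : ∫⁻ z, ENNReal.ofReal (g (ContinuousLinearMap.rotation θ z)) ∂(γ.prod γ) =
        ∫⁻ z, ENNReal.ofReal (g z) ∂(γ.prod γ) := by
      conv_rhs => rw [← h0]
      rw [lintegral_map (hgc.measurable.ennreal_ofReal)
        (ContinuousLinearMap.continuous _).measurable]
    rw [h1, lintegral_prod _ hgc.measurable.ennreal_ofReal.aemeasurable]
    calc ∫⁻ x, ∫⁻ y, ENNReal.ofReal (g (x, y)) ∂γ ∂γ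
        ≤ ∫⁻ _, ENNReal.ofReal (exp (π ^ 2 * L ^ 2 / 8)) ∂γ := by
          refine lintegral_mono fun x => ?_
          have h2 := lintegral_exp_stdGaussian ((π / 2) • fderiv ℝ f x)
          simp only [smul_apply, smul_eq_mul] at h2
          rw [h2]
          refine ENNReal.ofReal_le_ofReal (exp_le_exp.2 ?_)
          rw [norm_smul, Real.norm_of_nonneg (by positivity), mul_pow]
          have := pow_le_pow_left₀ (norm_nonneg _) (hL x) 2
          calc (π / 2) ^ 2 * ‖fderiv ℝ f x‖ ^ 2 / 2 ≤ (π / 2) ^ 2 * L ^ 2 / 2 := by gcongr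
            _ = _ := by ring
      _ = _ := by simp
  rw [lintegral_lintegral_swap]
  · calc ∫⁻ θ, ∫⁻ z, ENNReal.ofReal (g (ContinuousLinearMap.rotation θ z)) ∂(γ.prod γ) ∂V
        ≤ ∫⁻ _, ENNReal.ofReal (exp (π ^ 2 * L ^ 2 / 8)) ∂V := lintegral_mono hrot
      _ = _ := by simp
  · exact ((hgc.comp hrc).measurable.ennreal_ofReal).aemeasurable

end GaussianConcentration

section DirectionalNorm

variable {n : ℕ} {ν : Measure (EuclideanSpace ℝ (Fin n))} [IsProbabilityMeasure ν]

/-- The `L^m` norm of the marginal of `ν` in direction `t`. -/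
def dirNorm (ν : Measure (EuclideanSpace ℝ (Fin n))) (m : ℕ) (t : EuclideanSpace ℝ (Fin n)) : ℝ :=
  (∫ x, |⟪t, x⟫| ^ m ∂ν) ^ ((m : ℝ)⁻¹)

theorem LogConcaveMeasure.memLp_inner (h : LogConcaveMeasure ν) {m : ℕ} (hm : 1 ≤ m)
    (t : EuclideanSpace ℝ (Fin n)) : MemLp (fun x => ⟪t, x⟫) m ν := by
  have hc : Continuous fun x : EuclideanSpace ℝ (Fin n) => ⟪t, x⟫ := by fun_prop
  rw [← integrable_norm_rpow_iff hc.aestronglyMeasurable (by exact_mod_cast (by omega))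
    (ENNReal.natCast_ne_top m)]
  have := h.integrable_rpow (innerSL ℝ t) (q := m) (by exact_mod_cast hm)
  simpa using this

theorem LogConcaveMeasure.integrable_inner_pow (h : LogConcaveMeasure ν) {m : ℕ} (hm : 1 ≤ m)
    (t : EuclideanSpace ℝ (Fin n)) : Integrable (fun x => |⟪t, x⟫| ^ m) ν := by
  have := h.integrable_rpow (innerSL ℝ t) (q := m) (by exact_mod_cast hm)
  simpa using this

theorem dirNorm_nonneg (m : ℕ) (t : EuclideanSpace ℝ (Fin n)) : 0 ≤ dirNorm ν m t :=
  Real.rpow_nonneg (integral_nonneg fun _ => by positivity) _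

theorem dirNorm_pow {m : ℕ} (hm : 1 ≤ m) (t : EuclideanSpace ℝ (Fin n)) :
    dirNorm ν m t ^ m = ∫ x, |⟪t, x⟫| ^ m ∂ν :=
  Real.rpow_inv_natCast_pow (integral_nonneg fun _ => by positivity) (by omega)

theorem LogConcaveMeasure.dirNorm_eq (h : LogConcaveMeasure ν) {m : ℕ} (hm : 1 ≤ m)
    (t : EuclideanSpace ℝ (Fin n)) :
    dirNorm ν m t = (eLpNorm (fun x => ⟪t, x⟫) m ν).toReal := by
  rw [(h.memLp_inner hm t).eLpNorm_eq_integral_rpow_norm (by exact_mod_cast (by omega))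
    (ENNReal.natCast_ne_top m), ENNReal.toReal_ofReal (by positivity)]
  simp [dirNorm]

theorem LogConcaveMeasure.dirNorm_add_le (h : LogConcaveMeasure ν) {m : ℕ} (hm : 1 ≤ m)
    (t u : EuclideanSpace ℝ (Fin n)) :
    dirNorm ν m (t + u) ≤ dirNorm ν m t + dirNorm ν m u := by
  rw [h.dirNorm_eq hm, h.dirNorm_eq hm, h.dirNorm_eq hm,
    ← ENNReal.toReal_add (h.memLp_inner hm t).eLpNorm_ne_top (h.memLp_inner hm u).eLpNorm_ne_top]
  refine ENNReal.toReal_mono (ENNReal.add_ne_top.2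
    ⟨(h.memLp_inner hm t).eLpNorm_ne_top, (h.memLp_inner hm u).eLpNorm_ne_top⟩) ?_
  have : (fun x => ⟪t + u, x⟫) = (fun x => ⟪t, x⟫) + fun x => ⟪u, x⟫ := by
    ext x; simp [inner_add_left]
  rw [this]
  exact eLpNorm_add_le (h.memLp_inner hm t).1 (h.memLp_inner hm u).1 (by exact_mod_cast hm)

theorem dirNorm_smul {m : ℕ} (hm : 1 ≤ m) (c : ℝ) (t : EuclideanSpace ℝ (Fin n)) :
    dirNorm ν m (c • t) = |c| * dirNorm ν m t := by
  simp only [dirNorm, real_inner_smul_left, abs_mul, mul_pow]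
  rw [integral_const_mul, Real.mul_rpow (by positivity)
    (integral_nonneg fun _ => by positivity), Real.pow_rpow_inv_natCast (abs_nonneg _) (by omega)]

theorem LogConcaveMeasure.abs_dirNorm_sub_le (h : LogConcaveMeasure ν) {m : ℕ} (hm : 1 ≤ m)
    (t u : EuclideanSpace ℝ (Fin n)) :
    |dirNorm ν m t - dirNorm ν m u| ≤ dirNorm ν m (t - u) := by
  have h1 := h.dirNorm_add_le hm (t - u) u
  have h2 := h.dirNorm_add_le hm (u - t) t
  rw [sub_add_cancel] at h1 h2
  have h3 : dirNorm ν m (u - t) = dirNorm ν m (t - u) := by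
    have := dirNorm_smul (ν := ν) hm (-1) (t - u)
    simpa using this
  rw [abs_le]
  constructor <;> linarith

theorem LogConcaveMeasure.memLp_id (h : LogConcaveMeasure ν) {m : ℕ} (hm : 1 ≤ m) :
    MemLp (fun x => x) m ν := by
  refine MemLp.of_eval_piLp fun i => ?_
  have := h.memLp_inner hm (EuclideanSpace.single i 1)
  simpa [EuclideanSpace.inner_single_left] using this

theorem LogConcaveMeasure.integrable_norm_pow (h : LogConcaveMeasure ν) {m : ℕ} (hm : 1 ≤ m) :
    Integrable (fun x => ‖x‖ ^ m) ν :=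
  (h.memLp_id hm).integrable_norm_pow (by omega)

theorem LogConcaveMeasure.contDiff_integral_inner_pow (h : LogConcaveMeasure ν) {m : ℕ}
    (hm : 1 ≤ m) : ContDiff ℝ 1 fun t => ∫ x, ⟪t, x⟫ ^ m ∂ν := by
  have hprod : ∀ p : Fin m → Fin n,
      Integrable (fun x : EuclideanSpace ℝ (Fin n) => ∏ i, x (p i)) ν := by
    intro p
    refine (h.integrable_norm_pow hm).mono' (by fun_prop) (Filter.Eventually.of_forall fun x => ?_)
    rw [norm_prod]
    calc ∏ i, ‖x (p i)‖ ≤ ∏ _i : Fin m, ‖x‖ :=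
          Finset.prod_le_prod (fun _ _ => norm_nonneg _) fun i _ => PiLp.norm_apply_le x (p i)
      _ = ‖x‖ ^ m := by simp
  have hexp : (fun t : EuclideanSpace ℝ (Fin n) => ∫ x, ⟪t, x⟫ ^ m ∂ν) =
      fun t => ∑ p : Fin m → Fin n, (∏ i, t (p i)) * ∫ x, ∏ i, x (p i) ∂ν := by
    ext t
    simp_rw [← integral_const_mul]
    rw [← integral_finsetSum _ fun p _ => (hprod p).const_mul _]
    congr 1
    ext x
    rw [PiLp.inner_apply, Fintype.sum_pow]
    refine Finset.sum_congr rfl fun p _ => ?_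
    rw [← Finset.prod_mul_distrib]
    refine Finset.prod_congr rfl fun i _ => ?_
    simp [mul_comm]
  rw [hexp]
  fun_prop

theorem pow_add_sub_pow_le {a A d : ℝ} (ha : 0 ≤ a) (haA : a ≤ A) (hd : 0 ≤ d) (k : ℕ) :
    (a + d) ^ k - a ^ k ≤ (A + d) ^ k - A ^ k := by
  induction k with
  | zero => simp
  | succ k ih =>
    have h1 : a ^ k ≤ A ^ k := pow_le_pow_left₀ ha haA k
    have h2 : a ^ k ≤ (a + d) ^ k := pow_le_pow_left₀ ha (by linarith) k
    calc (a + d) ^ (k + 1) - a ^ (k + 1) = (a + d) * ((a + d) ^ k - a ^ k) + d * a ^ k := by ring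
      _ ≤ (A + d) * ((A + d) ^ k - A ^ k) + d * A ^ k := by
          have := sub_nonneg.2 h2
          have : 0 ≤ A + d := by linarith
          gcongr
      _ = _ := by ring

/-- A smooth Lipschitz approximation of `dirNorm`. -/
theorem LogConcaveMeasure.exists_smooth_approx (h : LogConcaveMeasure ν) {m : ℕ} (hm : 1 ≤ m)
    (heven : Even m) {s : ℝ} (hs : 0 ≤ s) (hN : ∀ u, dirNorm ν m u ≤ s * ‖u‖) {δ : ℝ}
    (hδ : 0 < δ) :
    ∃ f : EuclideanSpace ℝ (Fin n) → ℝ, ContDiff ℝ 1 f ∧ (∀ x, ‖fderiv ℝ f x‖ ≤ s) ∧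
      ∀ x, dirNorm ν m x ≤ f x ∧ f x ≤ dirNorm ν m x + δ := by
  have hm0 : m ≠ 0 := by omega
  have hF : ∀ t, ∫ x, ⟪t, x⟫ ^ m ∂ν = dirNorm ν m t ^ m := fun t => by
    rw [dirNorm_pow hm]; simp only [heven.pow_abs]
  set f : EuclideanSpace ℝ (Fin n) → ℝ :=
    fun t => (δ ^ m + ∫ x, ⟪t, x⟫ ^ m ∂ν) ^ ((m : ℝ)⁻¹) with hf
  have hpos : ∀ t, 0 < δ ^ m + dirNorm ν m t ^ m := fun t => by
    have := dirNorm_nonneg (ν := ν) m t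
    positivity
  have hf0 : ∀ t, 0 ≤ f t := fun t => by
    simp only [hf]; rw [hF]; exact Real.rpow_nonneg (hpos t).le _
  have hfm : ∀ t, f t ^ m = δ ^ m + dirNorm ν m t ^ m := fun t => by
    simp only [hf]; rw [hF, Real.rpow_inv_natCast_pow (hpos t).le hm0]
  have hlow : ∀ t, dirNorm ν m t ≤ f t := fun t => by
    refine le_of_pow_le_pow_left₀ hm0 (hf0 t) ?_
    rw [hfm]
    have : 0 < δ ^ m := by positivity
    linarith
  have hup : ∀ t, f t ≤ dirNorm ν m t + δ := fun t => by
    have := dirNorm_nonneg (ν := ν) m t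
    refine le_of_pow_le_pow_left₀ hm0 (by positivity) ?_
    rw [hfm, add_comm (dirNorm ν m t)]
    exact pow_add_pow_le hδ.le this hm0
  have hLip : ∀ t u, f u ≤ f t + s * ‖u - t‖ := fun t u => by
    have hd : 0 ≤ s * ‖u - t‖ := by positivity
    have h1 : dirNorm ν m u ≤ dirNorm ν m t + s * ‖u - t‖ := by
      have := h.dirNorm_add_le hm t (u - t)
      rw [add_sub_cancel] at this
      linarith [hN (u - t)]
    refine le_of_pow_le_pow_left₀ hm0 (add_nonneg (hf0 t) hd) ?_
    have h2 := pow_add_sub_pow_le (dirNorm_nonneg m t) (hlow t) hd m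
    have h3 := pow_le_pow_left₀ (dirNorm_nonneg m u) h1 m
    rw [hfm] at h2 ⊢
    linarith
  refine ⟨f, ?_, ?_, fun x => ⟨hlow x, hup x⟩⟩
  · exact (contDiff_const.add (h.contDiff_integral_inner_pow hm)).rpow_const_of_ne fun t => by
      rw [hF]; exact (hpos t).ne'
  · intro x
    have hL : LipschitzWith ⟨s, hs⟩ f := LipschitzWith.of_le_add_mul _ fun x y => by
      rw [dist_eq_norm]
      exact hLip y x
    exact norm_fderiv_le_of_lipschitz ℝ hL

theorem LogConcaveMeasure.continuous_dirNorm (h : LogConcaveMeasure ν) {m : ℕ} (hm : 1 ≤ m)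
    (heven : Even m) : Continuous (dirNorm ν m) := by
  have h1 := (h.contDiff_integral_inner_pow hm).continuous.rpow_const (p := (m : ℝ)⁻¹)
    fun t => Or.inr (by positivity)
  refine h1.congr fun t => ?_
  simp only [dirNorm, heven.pow_abs]

/-- Gaussian exponential concentration for `dirNorm`. -/
theorem LogConcaveMeasure.lintegral_exp_dirNorm_le (h : LogConcaveMeasure ν) {m : ℕ} (hm : 1 ≤ m)
    (heven : Even m) {s : ℝ} (hs : 0 ≤ s) (hN : ∀ u, dirNorm ν m u ≤ s * ‖u‖) {l : ℝ}
    (hl : 0 < l) :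
    ∫⁻ z, ENNReal.ofReal (exp (l * (dirNorm ν m z.2 - dirNorm ν m z.1)))
      ∂((stdGaussian (EuclideanSpace ℝ (Fin n))).prod (stdGaussian (EuclideanSpace ℝ (Fin n)))) ≤
      ENNReal.ofReal (exp (1 + 2 * l ^ 2 * s ^ 2)) := by
  obtain ⟨f, hfc, hfd, hfN⟩ := h.exists_smooth_approx hm heven hs hN (inv_pos.2 hl)
  have h1 := lintegral_exp_sub_stdGaussian_le (f := fun x => l * f x) (L := l * s)
    (contDiff_const.mul hfc) fun x => by
      rw [fderiv_const_mul ((hfc.differentiable (by norm_num)) x), norm_smul,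
        Real.norm_of_nonneg hl.le]
      exact mul_le_mul_of_nonneg_left (hfd x) hl.le
  set γ := stdGaussian (EuclideanSpace ℝ (Fin n))
  calc ∫⁻ z, ENNReal.ofReal (exp (l * (dirNorm ν m z.2 - dirNorm ν m z.1))) ∂(γ.prod γ)
      ≤ ∫⁻ z, ENNReal.ofReal (exp 1) * ENNReal.ofReal (exp (l * f z.2 - l * f z.1))
        ∂(γ.prod γ) := by
        refine lintegral_mono fun z => ?_
        rw [← ENNReal.ofReal_mul (exp_pos _).le, ← Real.exp_add]
        refine ENNReal.ofReal_le_ofReal (exp_le_exp.2 ?_)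
        have h2 := (hfN z.2).1
        have h3 := (hfN z.1).2
        have h4 : l * (dirNorm ν m z.2 - dirNorm ν m z.1) ≤ l * (f z.2 - f z.1 + l⁻¹) := by
          apply mul_le_mul_of_nonneg_left _ hl.le
          linarith
        have h5 : l * (f z.2 - f z.1 + l⁻¹) = 1 + (l * f z.2 - l * f z.1) := by
          field_simp
          ring
        linarith
    _ = ENNReal.ofReal (exp 1) * ∫⁻ z, ENNReal.ofReal (exp (l * f z.2 - l * f z.1))
        ∂(γ.prod γ) := by
        rw [lintegral_const_mul]
        have := hfc.continuous
        fun_prop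
    _ ≤ ENNReal.ofReal (exp 1) * ENNReal.ofReal (exp (π ^ 2 * (l * s) ^ 2 / 8)) := by
        gcongr
    _ ≤ _ := by
        rw [← ENNReal.ofReal_mul (exp_pos _).le, ← Real.exp_add]
        refine ENNReal.ofReal_le_ofReal (exp_le_exp.2 ?_)
        have hpi : π ^ 2 ≤ 16 := by
          have := Real.pi_le_four
          nlinarith [Real.pi_pos]
        have : π ^ 2 * (l * s) ^ 2 ≤ 16 * (l * s) ^ 2 := by gcongr
        nlinarith

end DirectionalNorm

section Net

variable {m : ℕ}

theorem card_le_of_separated_sphere (s : Finset (EuclideanSpace ℝ (Fin m)))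
    (hs : ∀ c ∈ s, ‖c‖ = 1) (h : ∀ c ∈ s, ∀ d ∈ s, c ≠ d → 1 / 32 ≤ ‖c - d‖) :
    s.card ≤ 65 ^ m := by
  set B := volume (Metric.ball (0 : EuclideanSpace ℝ (Fin m)) 1)
  have D : Set.PairwiseDisjoint (s : Set (EuclideanSpace ℝ (Fin m)))
      fun c => Metric.ball c (1 / 64) := by
    intro c hc d hd hcd
    apply Metric.ball_disjoint_ball
    rw [dist_eq_norm]
    have := h c hc d hd hcd
    norm_num at this ⊢
    exact this
  have hsub : (⋃ c ∈ s, Metric.ball c (1 / 64)) ⊆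
      Metric.ball (0 : EuclideanSpace ℝ (Fin m)) (65 / 64) := by
    refine Set.iUnion₂_subset fun x hx => Metric.ball_subset_ball' ?_
    rw [dist_zero_right, hs x hx]
    norm_num
  have h1 := measure_mono (μ := (volume : Measure (EuclideanSpace ℝ (Fin m)))) hsub
  rw [measure_biUnion_finset D fun c _ => measurableSet_ball] at h1
  simp only [Measure.addHaar_ball_of_pos _ _ (show (0 : ℝ) < 1 / 64 by norm_num),
    Measure.addHaar_ball_of_pos _ _ (show (0 : ℝ) < 65 / 64 by norm_num), Finset.sum_const,
    nsmul_eq_mul, finrank_euclideanSpace, Fintype.card_fin, ← mul_assoc] at h1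
  rw [ENNReal.mul_le_mul_iff_left (Metric.measure_ball_pos _ _ zero_lt_one).ne'
    measure_ball_lt_top.ne] at h1
  have h2 : (s.card : ℝ) ≤ 65 ^ m := by
    have := ENNReal.toReal_le_of_le_ofReal (by positivity) h1
    rw [ENNReal.toReal_mul, ENNReal.toReal_ofReal (by positivity), ENNReal.toReal_natCast,
      div_pow, div_pow, one_pow] at this
    have h64 : (0 : ℝ) < 64 ^ m := by positivity
    rw [mul_one_div] at this
    exact (div_le_div_iff_of_pos_right h64).1 this
  exact_mod_cast h2

/-- The unit sphere has a `1/32`-net of at most exponential cardinality. -/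
theorem exists_sphere_net (m : ℕ) : ∃ s : Finset (EuclideanSpace ℝ (Fin m)),
    s.card ≤ 65 ^ m ∧ (∀ c ∈ s, ‖c‖ = 1) ∧
      ∀ u : EuclideanSpace ℝ (Fin m), ‖u‖ = 1 → ∃ c ∈ s, ‖u - c‖ ≤ 1 / 32 := by
  classical
  set S : Set ℕ := {k | ∃ s : Finset (EuclideanSpace ℝ (Fin m)), s.card = k ∧
    (∀ c ∈ s, ‖c‖ = 1) ∧ ∀ c ∈ s, ∀ d ∈ s, c ≠ d → 1 / 32 ≤ ‖c - d‖}
  have hne : S.Nonempty := ⟨0, ∅, by simp⟩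
  have hbd : BddAbove S := ⟨65 ^ m, by
    rintro _ ⟨s, rfl, h1, h2⟩
    exact card_le_of_separated_sphere s h1 h2⟩
  obtain ⟨s, hcard, hs1, hs2⟩ := Nat.sSup_mem hne hbd
  refine ⟨s, card_le_of_separated_sphere s hs1 hs2, hs1, fun u hu => ?_⟩
  by_contra! hcon
  have hus : u ∉ s := fun hus => by
    have := hcon u hus
    norm_num at this
  have hmem : (insert u s).card ∈ S := by
    refine ⟨insert u s, rfl, ?_, ?_⟩
    · intro c hc
      rcases Finset.mem_insert.1 hc with rfl | hc
      exacts [hu, hs1 c hc]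
    · intro c hc d hd hcd
      rcases Finset.mem_insert.1 hc with hcu | hc' <;>
        rcases Finset.mem_insert.1 hd with hdu | hd'
      · exact absurd (hcu.trans hdu.symm) hcd
      · rw [hcu]; exact (hcon d hd').le
      · rw [hdu, norm_sub_rev]; exact (hcon c hc').le
      · exact hs2 c hc' d hd' hcd
  have := le_csSup hbd hmem
  rw [Finset.card_insert_of_notMem hus, hcard] at this
  omega

end Net

section GaussianMoments

variable {n : ℕ}

/-- The absolute moment of order `m` of a standard Gaussian variable. -/
def gaussMoment (m : ℕ) : ℝ := ∫ y, |y| ^ m ∂(gaussianReal 0 1)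

theorem integrable_abs_pow_gaussianReal (m : ℕ) :
    Integrable (fun y : ℝ => |y| ^ m) (gaussianReal 0 1) := by
  simpa using (memLp_id_gaussianReal (μ := 0) (v := 1) m).integrable_norm_pow'

theorem exp_two_le_eight : exp 2 ≤ 8 := by
  have := Real.exp_one_lt_d9
  rw [show (2 : ℝ) = ((2 : ℕ) : ℝ) * 1 by norm_num, Real.exp_nat_mul]
  calc exp 1 ^ 2 ≤ 2.7182818286 ^ 2 := by gcongr
    _ ≤ 8 := by norm_num

theorem le_gaussMoment {m : ℕ} (hm : 2 ≤ m) : (√m / 16) ^ m ≤ gaussMoment m := by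
  have hm' : (1 : ℝ) ≤ m := by exact_mod_cast (one_le_two.trans hm)
  have hsm : 1 ≤ √(m : ℝ) := Real.one_le_sqrt.2 hm'
  have hsq : √(m : ℝ) ^ 2 = m := Real.sq_sqrt (by positivity)
  have h1 : ∫ y in Set.Icc (√m) (2 * √m), |y| ^ m ∂(gaussianReal 0 1) ≤ gaussMoment m :=
    setIntegral_le_integral (integrable_abs_pow_gaussianReal m)
      (Filter.Eventually.of_forall fun y => by positivity)
  refine le_trans ?_ h1
  have h2 : √(m : ℝ) ^ m * (gaussianReal 0 1).real (Set.Icc (√m) (2 * √m)) ≤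
      ∫ y in Set.Icc (√m) (2 * √m), |y| ^ m ∂(gaussianReal 0 1) := by
    rw [mul_comm, ← smul_eq_mul, ← setIntegral_const]
    refine setIntegral_mono_on (integrable_const _).integrableOn
      (integrable_abs_pow_gaussianReal m).integrableOn measurableSet_Icc fun y hy => ?_
    exact pow_le_pow_left₀ (by positivity) (hy.1.trans (le_abs_self y)) m
  refine le_trans ?_ h2
  rw [div_pow, div_eq_mul_inv]
  refine mul_le_mul_of_nonneg_left ?_ (by positivity)
  have h3 : exp (-2 * m) / 3 * √m ≤ (gaussianReal 0 1).real (Set.Icc (√m) (2 * √m)) := by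
    rw [measureReal_def, gaussianReal_apply_eq_integral _ (by norm_num),
      ENNReal.toReal_ofReal (integral_nonneg fun x => gaussianPDFReal_nonneg _ _ _)]
    have h4 : ∫ _ in Set.Icc (√(m : ℝ)) (2 * √m), exp (-2 * m) / 3 = exp (-2 * m) / 3 * √m := by
      rw [setIntegral_const, measureReal_def, Real.volume_Icc, ENNReal.toReal_ofReal (by linarith),
        smul_eq_mul]
      ring
    rw [← h4]
    refine setIntegral_mono_on (by simp) (integrable_gaussianPDFReal 0 1).integrableOn
      measurableSet_Icc fun y hy => ?_
    rw [gaussianPDFReal, div_eq_inv_mul]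
    have h5 : √(2 * π * ((1 : NNReal) : ℝ)) ≤ 3 := by
      rw [Real.sqrt_le_iff]
      have := Real.pi_lt_d2
      norm_num
      linarith
    have hy2 : y ^ 2 ≤ 4 * m := by
      have := pow_le_pow_left₀ (by linarith [hy.1]) hy.2 2
      rw [mul_pow, hsq] at this
      linarith
    have h6 : -2 * (m : ℝ) ≤ -(y - 0) ^ 2 / (2 * ((1 : NNReal) : ℝ)) := by
      norm_num
      linarith
    gcongr
  refine le_trans ?_ h3
  have h7 := exp_two_le_eight
  have h8 : ((8 : ℝ) ^ m)⁻¹ ≤ exp (-2 * m) := by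
    rw [show -2 * (m : ℝ) = -((m : ℝ) * 2) by ring, Real.exp_neg, Real.exp_nat_mul]
    gcongr
  have h9 : ((16 : ℝ) ^ m)⁻¹ ≤ ((8 : ℝ) ^ m)⁻¹ / 3 * √m := by
    have h10 : (3 : ℝ) ≤ 2 ^ m := by
      calc (3 : ℝ) ≤ 2 ^ 2 := by norm_num
        _ ≤ 2 ^ m := pow_le_pow_right₀ (by norm_num) hm
    rw [show (16 : ℝ) = 8 * 2 by norm_num, mul_pow, mul_inv, div_mul_eq_mul_div, mul_div_assoc]
    refine mul_le_mul_of_nonneg_left ?_ (by positivity)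
    rw [inv_le_comm₀ (by positivity) (by positivity), inv_div]
    calc 3 / √(m : ℝ) ≤ 3 / 1 := by gcongr
      _ ≤ 2 ^ m := by linarith
  calc ((16 : ℝ) ^ m)⁻¹ ≤ ((8 : ℝ) ^ m)⁻¹ / 3 * √m := h9
    _ ≤ _ := by gcongr

theorem lintegral_abs_inner_pow_stdGaussian {m : ℕ} (hm : 1 ≤ m)
    (x : EuclideanSpace ℝ (Fin n)) :
    ∫⁻ t, ENNReal.ofReal (|⟪t, x⟫| ^ m) ∂(stdGaussian (EuclideanSpace ℝ (Fin n))) =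
      ENNReal.ofReal (gaussMoment m) * ENNReal.ofReal (‖x‖ ^ m) := by
  have hg : 0 ≤ gaussMoment m := integral_nonneg fun _ => by positivity
  rcases eq_or_ne x 0 with rfl | hx
  · simp [show m ≠ 0 by omega]
  have hx0 : 0 < ‖x‖ := norm_pos_iff.2 hx
  have hn : ‖innerSL ℝ (‖x‖⁻¹ • x)‖ = 1 := by
    rw [innerSL_apply_norm, norm_smul, norm_inv, norm_norm, inv_mul_cancel₀ hx0.ne']
  have h1 := map_stdGaussian_clm (innerSL ℝ (‖x‖⁻¹ • x))
  rw [hn] at h1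
  simp only [one_pow, Real.toNNReal_one] at h1
  have h2 : ∀ t, |⟪t, x⟫| ^ m = ‖x‖ ^ m * |innerSL ℝ (‖x‖⁻¹ • x) t| ^ m := by
    intro t
    rw [innerSL_apply_apply, real_inner_smul_left, ← mul_pow, abs_mul, abs_inv, abs_norm,
      mul_inv_cancel_left₀ hx0.ne', real_inner_comm]
  simp_rw [h2]
  rw [gaussMoment, ofReal_integral_eq_lintegral_ofReal (integrable_abs_pow_gaussianReal m)
    (Filter.Eventually.of_forall fun y => by positivity), ← h1,
    lintegral_map (by fun_prop) (by fun_prop), mul_comm, ← lintegral_const_mul _ (by fun_prop)]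
  refine lintegral_congr fun t => ?_
  rw [ENNReal.ofReal_mul (by positivity)]

/-- The Gaussian average of the `m`-th power of `dirNorm`. -/
theorem LogConcaveMeasure.lintegral_dirNorm_pow {ν : Measure (EuclideanSpace ℝ (Fin n))}
    [IsProbabilityMeasure ν] (h : LogConcaveMeasure ν) {m : ℕ} (hm : 1 ≤ m) :
    ∫⁻ t, ENNReal.ofReal (dirNorm ν m t ^ m) ∂(stdGaussian (EuclideanSpace ℝ (Fin n))) =
      ENNReal.ofReal (gaussMoment m * ∫ x, ‖x‖ ^ m ∂ν) := by
  have hg : 0 ≤ gaussMoment m := integral_nonneg fun _ => by positivity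
  have h1 : ∀ t, ENNReal.ofReal (dirNorm ν m t ^ m) = ∫⁻ x, ENNReal.ofReal (|⟪t, x⟫| ^ m) ∂ν := by
    intro t
    rw [dirNorm_pow hm, ofReal_integral_eq_lintegral_ofReal (h.integrable_inner_pow hm t)
      (Filter.Eventually.of_forall fun y => by positivity)]
  simp_rw [h1]
  rw [lintegral_lintegral_swap]
  · simp_rw [lintegral_abs_inner_pow_stdGaussian hm]
    rw [lintegral_const_mul _ (by fun_prop), ENNReal.ofReal_mul hg,
      ofReal_integral_eq_lintegral_ofReal (h.integrable_norm_pow hm)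
      (Filter.Eventually.of_forall fun y => by positivity)]
  · fun_prop

end GaussianMoments

section Concentration

variable {n : ℕ} {ν : Measure (EuclideanSpace ℝ (Fin n))} [IsProbabilityMeasure ν]

theorem LogConcaveMeasure.real_dirNorm_mul_le (h : LogConcaveMeasure ν) {m : ℕ} (hm : 1 ≤ m)
    (heven : Even m) {s : ℝ} (hs : 0 < s) (hN : ∀ u, dirNorm ν m u ≤ s * ‖u‖) {a b : ℝ}
    (hab : a < b) :
    (stdGaussian (EuclideanSpace ℝ (Fin n))).real {x | dirNorm ν m x ≤ a} *
      (stdGaussian (EuclideanSpace ℝ (Fin n))).real {x | b ≤ dirNorm ν m x} ≤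
      exp (1 - (b - a) ^ 2 / (8 * s ^ 2)) := by
  set γ := stdGaussian (EuclideanSpace ℝ (Fin n))
  set N := dirNorm ν m
  have hc : Continuous N := h.continuous_dirNorm hm heven
  set l := (b - a) / (4 * s ^ 2) with hl
  have hl0 : 0 < l := by have := sub_pos.2 hab; positivity
  have h1 := h.lintegral_exp_dirNorm_le hm heven hs.le hN hl0
  have h2 := mul_meas_ge_le_lintegral (μ := γ.prod γ)
    (f := fun z => ENNReal.ofReal (exp (l * (N z.2 - N z.1)))) (by fun_prop)
    (ENNReal.ofReal (exp (l * (b - a))))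
  have h3 : {x | N x ≤ a} ×ˢ {x | b ≤ N x} ⊆
      {z | ENNReal.ofReal (exp (l * (b - a))) ≤ ENNReal.ofReal (exp (l * (N z.2 - N z.1)))} := by
    rintro ⟨x, y⟩ ⟨hx, hy⟩
    have hx' : N x ≤ a := hx
    have hy' : b ≤ N y := hy
    refine ENNReal.ofReal_le_ofReal (Real.exp_le_exp.2 ?_)
    gcongr
  have h4 := ((mul_le_mul_right (measure_mono (μ := γ.prod γ) h3) _).trans h2).trans h1
  rw [Measure.prod_prod, ← ofReal_measureReal, ← ofReal_measureReal,
    ← ENNReal.ofReal_mul (by positivity), ← ENNReal.ofReal_mul (by positivity),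
    ENNReal.ofReal_le_ofReal_iff (by positivity)] at h4
  have h5 : exp (1 - (b - a) ^ 2 / (8 * s ^ 2)) =
      exp (1 + 2 * l ^ 2 * s ^ 2) / exp (l * (b - a)) := by
    rw [← Real.exp_sub, hl]
    congr 1
    field_simp
    ring
  rw [h5, le_div_iff₀ (by positivity), mul_comm]
  exact h4

theorem LogConcaveMeasure.real_dirNorm_le_half_lt (h : LogConcaveMeasure ν) {m : ℕ} (hm : 2 ≤ m)
    (heven : Even m) {s : ℝ} (hs : 0 < s) (hN : ∀ u, dirNorm ν m u ≤ s * ‖u‖) {W : ℝ}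
    (hW : ∫⁻ x, ENNReal.ofReal (dirNorm ν m x ^ m) ∂(stdGaussian (EuclideanSpace ℝ (Fin n))) =
      ENNReal.ofReal (W ^ m)) (hWs : 120 * s * √m < W) :
    (stdGaussian (EuclideanSpace ℝ (Fin n))).real {x | dirNorm ν m x ≤ W / 2} < 1 / 4 := by
  by_contra! hcon
  set γ := stdGaussian (EuclideanSpace ℝ (Fin n))
  set N := dirNorm ν m
  have hm1 : 1 ≤ m := by omega
  have hm0 : (0 : ℝ) < m := by exact_mod_cast hm1
  have hc : Continuous N := h.continuous_dirNorm hm1 heven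
  have hsq : √(m : ℝ) ^ 2 = m := Real.sq_sqrt (by positivity)
  have hsm : 0 < √(m : ℝ) := Real.sqrt_pos.2 hm0
  have hW0 : 0 < W := lt_trans (by positivity) hWs
  set l := √m / s with hl
  have hl0 : 0 < l := by positivity
  have h1 := h.lintegral_exp_dirNorm_le hm1 heven hs.le hN hl0
  have h2 : 2 * l ^ 2 * s ^ 2 = 2 * m := by
    rw [hl, div_pow, hsq]; field_simp
  rw [h2] at h1
  set I := ∫⁻ y, ENNReal.ofReal (exp (l * (N y - W / 2))) ∂γ with hI
  have h3 : I * ENNReal.ofReal (1 / 4) ≤ ENNReal.ofReal (exp (1 + 2 * m)) := by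
    refine le_trans ?_ h1
    rw [lintegral_prod (fun z => ENNReal.ofReal (exp (l * (N z.2 - N z.1)))) (by fun_prop)]
    calc I * ENNReal.ofReal (1 / 4) ≤ I * γ {x | N x ≤ W / 2} := by
          gcongr
          rw [← ofReal_measureReal]
          exact ENNReal.ofReal_le_ofReal hcon
      _ = ∫⁻ _ in {x | N x ≤ W / 2}, I ∂γ := by rw [setLIntegral_const]
      _ ≤ ∫⁻ x in {x | N x ≤ W / 2},
          ∫⁻ y, ENNReal.ofReal (exp (l * (N y - N x))) ∂γ ∂γ := by
          refine setLIntegral_mono' (measurableSet_le hc.measurable measurable_const) fun x hx => ?_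
          refine lintegral_mono fun y => ENNReal.ofReal_le_ofReal (Real.exp_le_exp.2 ?_)
          have : N x ≤ W / 2 := hx
          gcongr
      _ ≤ _ := setLIntegral_le_lintegral _ _
  have h4 : I ≤ ENNReal.ofReal (4 * exp (1 + 2 * m)) := by
    calc I = I * ENNReal.ofReal (1 / 4) * ENNReal.ofReal 4 := by
          rw [mul_assoc, ← ENNReal.ofReal_mul (by norm_num)]; norm_num
      _ ≤ ENNReal.ofReal (exp (1 + 2 * m)) * ENNReal.ofReal 4 := by gcongr
      _ = _ := by rw [← ENNReal.ofReal_mul (by positivity), mul_comm]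
  have h5 : ∀ x, N x ^ m ≤ (3 * W / 4) ^ m + (3 * s * √m) ^ m * exp (l * (N x - W / 2)) := by
    intro x
    have hNx : 0 ≤ N x := dirNorm_nonneg m x
    rcases le_total (N x) (3 * W / 4) with hx | hx
    · have := pow_le_pow_left₀ hNx hx m
      have h6 : 0 ≤ (3 * s * √m) ^ m * exp (l * (N x - W / 2)) := by positivity
      linarith
    · have hv : 0 ≤ N x - W / 2 := by linarith
      have h6 : N x ≤ 3 * (N x - W / 2) := by linarith
      have h7 := Real.pow_div_factorial_le_exp (l * (N x - W / 2)) (by positivity) m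
      have h8 : (m.factorial : ℝ) ≤ (m : ℝ) ^ m := by exact_mod_cast Nat.factorial_le_pow m
      have h9 : (l * (N x - W / 2)) ^ m ≤ (m : ℝ) ^ m * exp (l * (N x - W / 2)) := by
        rw [div_le_iff₀ (by positivity), mul_comm (exp _)] at h7
        exact h7.trans (by gcongr)
      have h10 : N x ^ m ≤ (3 * s * √m) ^ m * exp (l * (N x - W / 2)) := by
        calc N x ^ m ≤ (3 * (N x - W / 2)) ^ m := pow_le_pow_left₀ hNx h6 m
          _ = (3 * s / √m) ^ m * (l * (N x - W / 2)) ^ m := by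
            rw [← mul_pow, hl]; congr 1; field_simp
          _ ≤ (3 * s / √m) ^ m * ((m : ℝ) ^ m * exp (l * (N x - W / 2))) := by gcongr
          _ = _ := by
            rw [← mul_assoc, ← mul_pow]
            congr 2
            rw [div_mul_eq_mul_div, div_eq_iff hsm.ne', mul_assoc _ √(m : ℝ), ← sq, hsq]
      have : 0 ≤ (3 * W / 4) ^ m := by positivity
      linarith
  have h6 : ENNReal.ofReal (W ^ m) ≤
      ENNReal.ofReal ((3 * W / 4) ^ m + (3 * s * √m) ^ m * (4 * exp (1 + 2 * m))) := by
    rw [← hW]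
    calc ∫⁻ x, ENNReal.ofReal (N x ^ m) ∂γ
        ≤ ∫⁻ x, (ENNReal.ofReal ((3 * W / 4) ^ m) +
          ENNReal.ofReal ((3 * s * √m) ^ m) * ENNReal.ofReal (exp (l * (N x - W / 2)))) ∂γ := by
          refine lintegral_mono fun x => ?_
          rw [← ENNReal.ofReal_mul (by positivity), ← ENNReal.ofReal_add (by positivity)
            (by positivity)]
          exact ENNReal.ofReal_le_ofReal (h5 x)
      _ = ENNReal.ofReal ((3 * W / 4) ^ m) + ENNReal.ofReal ((3 * s * √m) ^ m) * I := by
          rw [lintegral_add_left (by fun_prop), lintegral_const, measure_univ, mul_one,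
            lintegral_const_mul _ (by fun_prop)]
      _ ≤ ENNReal.ofReal ((3 * W / 4) ^ m) +
          ENNReal.ofReal ((3 * s * √m) ^ m) * ENNReal.ofReal (4 * exp (1 + 2 * m)) := by gcongr
      _ = _ := by
          rw [← ENNReal.ofReal_mul (by positivity), ← ENNReal.ofReal_add (by positivity)
            (by positivity)]
  rw [ENNReal.ofReal_le_ofReal_iff (by positivity)] at h6
  have h7 : (3 * W / 4) ^ m ≤ 9 / 16 * W ^ m := by
    rw [show 3 * W / 4 = 3 / 4 * W by ring, mul_pow]
    gcongr
    calc (3 / 4 : ℝ) ^ m ≤ (3 / 4) ^ 2 := pow_le_pow_of_le_one (by norm_num) (by norm_num) hm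
      _ = 9 / 16 := by norm_num
  have h8 : exp (1 + 2 * m) ≤ 2.72 * 8 ^ m := by
    rw [Real.exp_add, mul_comm 2, Real.exp_nat_mul]
    have := Real.exp_one_lt_d9
    have h9 := exp_two_le_eight
    gcongr
    linarith
  have h9 : (120 * s * √m) ^ m < W ^ m := pow_lt_pow_left₀ hWs (by positivity) (by omega)
  have h10 : (25 : ℝ) ≤ 5 ^ m := by
    calc (25 : ℝ) = 5 ^ 2 := by norm_num
      _ ≤ 5 ^ m := pow_le_pow_right₀ (by norm_num) hm
  have h11 : (120 * s * √m) ^ m = 5 ^ m * ((3 * s * √m) ^ m * 8 ^ m) := by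
    rw [← mul_pow, ← mul_pow]; congr 1; ring
  have h12 : 25 * ((3 * s * √m) ^ m * 8 ^ m) ≤ 5 ^ m * ((3 * s * √m) ^ m * 8 ^ m) := by gcongr
  have h13 : (3 * s * √m) ^ m * (4 * exp (1 + 2 * m)) ≤
      (3 * s * √m) ^ m * (4 * (2.72 * 8 ^ m)) := by gcongr
  have h14 : 0 < (3 * s * √m) ^ m * 8 ^ m := by positivity
  nlinarith

theorem LogConcaveMeasure.real_dirNorm_notMem_Ioo_le (h : LogConcaveMeasure ν) {m : ℕ} (hm : 2 ≤ m)
    (heven : Even m) {s : ℝ} (hs : 0 < s) (hN : ∀ u, dirNorm ν m u ≤ s * ‖u‖) {W : ℝ}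
    (hW : ∫⁻ x, ENNReal.ofReal (dirNorm ν m x ^ m) ∂(stdGaussian (EuclideanSpace ℝ (Fin n))) =
      ENNReal.ofReal (W ^ m)) (hWs : 120 * s * √m < W) :
    (stdGaussian (EuclideanSpace ℝ (Fin n))).real
      {x | ¬(W / 4 < dirNorm ν m x ∧ dirNorm ν m x < 3 * W)} ≤ 8 * (1 / 2000) ^ m := by
  have h1 := h.real_dirNorm_le_half_lt hm heven hs hN hW hWs
  set γ := stdGaussian (EuclideanSpace ℝ (Fin n))
  set N := dirNorm ν m
  have hm1 : 1 ≤ m := by omega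
  have hm0 : (1 : ℝ) ≤ m := by exact_mod_cast hm1
  have hc : Continuous N := h.continuous_dirNorm hm1 heven
  have hsq : √(m : ℝ) ^ 2 = m := Real.sq_sqrt (by positivity)
  have hW0 : 0 < W := lt_of_le_of_lt (by positivity) hWs
  have h2 : γ.real {x | 2 * W ≤ N x} ≤ 1 / 4 := by
    have h3 := mul_meas_ge_le_lintegral (μ := γ) (f := fun z => ENNReal.ofReal (N z ^ m))
      (by fun_prop) (ENNReal.ofReal ((2 * W) ^ m))
    have h4 : {x | 2 * W ≤ N x} ⊆
        {x | ENNReal.ofReal ((2 * W) ^ m) ≤ ENNReal.ofReal (N x ^ m)} := fun x hx =>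
      ENNReal.ofReal_le_ofReal (pow_le_pow_left₀ (by positivity) hx m)
    have h5 := (mul_le_mul_right (measure_mono (μ := γ) h4) _).trans h3
    rw [hW, ← ofReal_measureReal, ← ENNReal.ofReal_mul (by positivity),
      ENNReal.ofReal_le_ofReal_iff (by positivity), mul_pow] at h5
    have h6 : (4 : ℝ) ≤ 2 ^ m := by
      calc (4 : ℝ) = 2 ^ 2 := by norm_num
        _ ≤ 2 ^ m := pow_le_pow_right₀ (by norm_num) hm
    have h7 : 0 < W ^ m := by positivity
    have h8 : 2 ^ m * γ.real {x | 2 * W ≤ N x} ≤ 1 := by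
      refine le_of_mul_le_mul_right ?_ h7
      linarith
    have h9 : 0 ≤ γ.real {x | 2 * W ≤ N x} := measureReal_nonneg
    nlinarith
  have h3 : 3 / 4 ≤ γ.real {x | W / 2 ≤ N x} := by
    have h4 : γ.real ({x | N x ≤ W / 2} ∪ {x | W / 2 ≤ N x}) = 1 := by
      have huniv : {x | N x ≤ W / 2} ∪ {x | W / 2 ≤ N x} = Set.univ :=
        by
        ext x
        simpa using le_total (N x) _
      rw [huniv]
      simp
    have := measureReal_union_le (μ := γ) {x | N x ≤ W / 2} {x | W / 2 ≤ N x}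
    linarith
  have h4 : 3 / 4 ≤ γ.real {x | N x ≤ 2 * W} := by
    have h4 : γ.real ({x | N x ≤ 2 * W} ∪ {x | 2 * W ≤ N x}) = 1 := by
      have huniv : {x | N x ≤ 2 * W} ∪ {x | 2 * W ≤ N x} = Set.univ :=
        by
        ext x
        simpa using le_total (N x) _
      rw [huniv]
      simp
    have := measureReal_union_le (μ := γ) {x | N x ≤ 2 * W} {x | 2 * W ≤ N x}
    linarith
  have h5 := h.real_dirNorm_mul_le hm1 heven hs hN (show W / 4 < W / 2 by linarith)
  have h6 := h.real_dirNorm_mul_le hm1 heven hs hN (show 2 * W < 3 * W by linarith)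
  have h7 : 14400 * s ^ 2 * m ≤ W ^ 2 := by
    have := pow_le_pow_left₀ (by positivity) hWs.le 2
    rw [mul_pow, hsq] at this
    linarith
  have hexp : exp (-(8 * (m : ℝ))) ≤ (1 / 2000) ^ m := by
    rw [Real.exp_neg, mul_comm, Real.exp_nat_mul, one_div, inv_pow]
    gcongr
    have := Real.exp_one_gt_d9
    rw [show (8 : ℝ) = ((8 : ℕ) : ℝ) * 1 by norm_num, Real.exp_nat_mul]
    calc (2000 : ℝ) ≤ 2.7182818283 ^ 8 := by norm_num
      _ ≤ exp 1 ^ 8 := by gcongr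
  have h8 : ∀ d : ℝ, W / 4 ≤ d → exp (1 - d ^ 2 / (8 * s ^ 2)) ≤ (1 / 2000) ^ m := by
    intro d hd
    refine le_trans (Real.exp_le_exp.2 ?_) hexp
    have h9 : 9 * m ≤ d ^ 2 / (8 * s ^ 2) := by
      rw [le_div_iff₀ (by positivity)]
      have := pow_le_pow_left₀ (by positivity) hd 2
      have : 0 ≤ s ^ 2 * m := by positivity
      nlinarith
    linarith
  have h9 := h8 (W / 2 - W / 4) (by linarith)
  have h10 := h8 (3 * W - 2 * W) (by linarith)
  have h11 : {x | ¬(W / 4 < N x ∧ N x < 3 * W)} ⊆ {x | N x ≤ W / 4} ∪ {x | 3 * W ≤ N x} := by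
    intro x hx
    by_contra! hcon
    simp only [Set.mem_union, Set.mem_ofPred_eq, not_or, not_le] at hcon
    exact hx hcon
  have h12 := (measureReal_mono (μ := γ) h11).trans (measureReal_union_le _ _)
  have h13 : 0 ≤ γ.real {x | N x ≤ W / 4} := measureReal_nonneg
  have h14 : 0 ≤ γ.real {x | 3 * W ≤ N x} := measureReal_nonneg
  nlinarith

end Concentration

section GaussianOperator

variable {n m : ℕ}

/-- The operator `u ↦ ∑ j, u j • ω j` with columns `ω j`. -/
def columnMap (ω : PiLp 2 fun _ : Fin m => EuclideanSpace ℝ (Fin n)) :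
    EuclideanSpace ℝ (Fin m) →ₗ[ℝ] EuclideanSpace ℝ (Fin n) where
  toFun u := ∑ j, u j • ω j
  map_add' u v := by simp [add_smul, Finset.sum_add_distrib]
  map_smul' c u := by simp [Finset.smul_sum, mul_smul]

/-- The adjoint of `columnMap`. -/
def rowMap (ω : PiLp 2 fun _ : Fin m => EuclideanSpace ℝ (Fin n)) :
    EuclideanSpace ℝ (Fin n) →L[ℝ] EuclideanSpace ℝ (Fin m) :=
  (EuclideanSpace.equiv (Fin m) ℝ).symm.toContinuousLinearMap ∘L
    ContinuousLinearMap.pi fun j => innerSL ℝ (ω j)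

theorem rowMap_apply (ω : PiLp 2 fun _ : Fin m => EuclideanSpace ℝ (Fin n))
    (x : EuclideanSpace ℝ (Fin n)) (j : Fin m) : rowMap ω x j = ⟪ω j, x⟫ := by
  simp [rowMap]

theorem inner_rowMap (ω : PiLp 2 fun _ : Fin m => EuclideanSpace ℝ (Fin n))
    (u : EuclideanSpace ℝ (Fin m)) (x : EuclideanSpace ℝ (Fin n)) :
    ⟪u, rowMap ω x⟫ = ⟪columnMap ω u, x⟫ := by
  rw [PiLp.inner_apply]
  simp only [columnMap, LinearMap.coe_mk, AddHom.coe_mk, sum_inner, real_inner_smul_left,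
    rowMap_apply]
  exact Finset.sum_congr rfl fun j _ => mul_comm _ _

theorem continuous_columnMap_left (u : EuclideanSpace ℝ (Fin m)) :
    Continuous fun ω : PiLp 2 fun _ : Fin m => EuclideanSpace ℝ (Fin n) => columnMap ω u := by
  simp only [columnMap, LinearMap.coe_mk, AddHom.coe_mk]
  fun_prop

/-- A unit combination of independent standard Gaussian vectors is standard Gaussian. -/
theorem map_columnMap_stdGaussian {u : EuclideanSpace ℝ (Fin m)} (hu : ‖u‖ = 1) :
    (stdGaussian (PiLp 2 fun _ : Fin m => EuclideanSpace ℝ (Fin n))).map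
      (fun ω => columnMap ω u) = stdGaussian (EuclideanSpace ℝ (Fin n)) := by
  have hmeas := (continuous_columnMap_left (n := n) u).measurable
  have : IsProbabilityMeasure
      ((stdGaussian (PiLp 2 fun _ : Fin m => EuclideanSpace ℝ (Fin n))).map
        (fun ω => columnMap ω u)) := Measure.isProbabilityMeasure_map hmeas.aemeasurable
  refine Measure.ext_of_charFun (funext fun t => ?_)
  set v : PiLp 2 fun _ : Fin m => EuclideanSpace ℝ (Fin n) := WithLp.toLp 2 fun j => u j • t with hv
  have h1 : ∀ ω : PiLp 2 fun _ : Fin m => EuclideanSpace ℝ (Fin n),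
      ⟪columnMap ω u, t⟫ = ⟪ω, v⟫ := by
    intro ω
    rw [PiLp.inner_apply ω v]
    simp only [columnMap, LinearMap.coe_mk, AddHom.coe_mk, sum_inner, real_inner_smul_left,
      real_inner_smul_right, hv]
  have h2 : ‖v‖ = ‖t‖ := by
    have h3 : ‖v‖ ^ 2 = ‖t‖ ^ 2 := by
      rw [PiLp.norm_sq_eq_of_L2]
      simp only [hv, norm_smul, mul_pow]
      rw [← Finset.sum_mul, ← EuclideanSpace.norm_sq_eq, hu]
      ring
    exact (pow_left_inj₀ (norm_nonneg _) (norm_nonneg _) two_ne_zero).1 h3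
  have h4 : charFun ((stdGaussian (PiLp 2 fun _ : Fin m => EuclideanSpace ℝ (Fin n))).map
      (fun ω => columnMap ω u)) t =
      charFun (stdGaussian (PiLp 2 fun _ : Fin m => EuclideanSpace ℝ (Fin n))) v := by
    rw [charFun_apply, charFun_apply, integral_map hmeas.aemeasurable (by fun_prop)]
    simp_rw [h1]
  rw [h4, charFun_stdGaussian, charFun_stdGaussian, h2]

theorem gaussMoment_two : gaussMoment 2 = 1 := by
  have h1 := variance_id_gaussianReal (μ := 0) (v := 1)
  rw [variance_of_integral_eq_zero aemeasurable_id (by simp)] at h1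
  simpa [gaussMoment] using h1

theorem lintegral_norm_rowMap_sq (x : EuclideanSpace ℝ (Fin n)) :
    ∫⁻ ω, ENNReal.ofReal (‖rowMap ω x‖ ^ 2)
      ∂(stdGaussian (PiLp 2 fun _ : Fin m => EuclideanSpace ℝ (Fin n))) =
      ENNReal.ofReal (m * ‖x‖ ^ 2) := by
  have h1 : ∀ ω : PiLp 2 fun _ : Fin m => EuclideanSpace ℝ (Fin n),
      ENNReal.ofReal (‖rowMap ω x‖ ^ 2) =
        ∑ j, ENNReal.ofReal (|⟪columnMap ω (EuclideanSpace.single j (1 : ℝ)), x⟫| ^ 2) := by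
    intro ω
    rw [EuclideanSpace.norm_sq_eq, ENNReal.ofReal_sum_of_nonneg fun _ _ => by positivity]
    refine Finset.sum_congr rfl fun j _ => ?_
    rw [← inner_rowMap, EuclideanSpace.inner_single_left]
    simp
  simp_rw [h1]
  rw [lintegral_finsetSum]
  · have h2 : ∀ j : Fin m, ∫⁻ ω,
        ENNReal.ofReal (|⟪columnMap ω (EuclideanSpace.single j (1 : ℝ)), x⟫| ^ 2)
        ∂(stdGaussian (PiLp 2 fun _ : Fin m => EuclideanSpace ℝ (Fin n))) =
        ENNReal.ofReal (‖x‖ ^ 2) := by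
      intro j
      have h3 := map_columnMap_stdGaussian (n := n) (m := m)
        (u := EuclideanSpace.single j (1 : ℝ)) (by simp)
      have h4 := lintegral_abs_inner_pow_stdGaussian (m := 2) (by norm_num) x
      rw [← h3, lintegral_map (by fun_prop) (continuous_columnMap_left _).measurable,
        gaussMoment_two, ENNReal.ofReal_one, one_mul] at h4
      exact h4
    simp_rw [h2]
    rw [Finset.sum_const, Finset.card_univ, Fintype.card_fin, nsmul_eq_mul,
      ENNReal.ofReal_mul (by positivity), ENNReal.ofReal_natCast]
  · intro j _
    have := (continuous_columnMap_left (n := n) (EuclideanSpace.single j (1 : ℝ)))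
    fun_prop

end GaussianOperator

section Paouris

variable {n : ℕ} {ν : Measure (EuclideanSpace ℝ (Fin n))} [IsProbabilityMeasure ν]

/-- If `dirNorm` is well-behaved on a net, then it is bounded below on the sphere. -/
theorem LogConcaveMeasure.le_dirNorm_columnMap (h : LogConcaveMeasure ν) {m k : ℕ} (hk : 1 ≤ k)
    (heven : Even k) {W : ℝ} {s : Finset (EuclideanSpace ℝ (Fin m))}
    (hs : ∀ u : EuclideanSpace ℝ (Fin m), ‖u‖ = 1 → ∃ c ∈ s, ‖u - c‖ ≤ 1 / 32)
    (ω : PiLp 2 fun _ : Fin m => EuclideanSpace ℝ (Fin n))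
    (hω : ∀ c ∈ s, W / 4 < dirNorm ν k (columnMap ω c) ∧ dirNorm ν k (columnMap ω c) < 3 * W)
    {u : EuclideanSpace ℝ (Fin m)} (hu : ‖u‖ = 1) : W / 8 ≤ dirNorm ν k (columnMap ω u) := by
  have hc : Continuous fun u => dirNorm ν k (columnMap ω u) :=
    (h.continuous_dirNorm hk heven).comp (LinearMap.continuous_of_finiteDimensional _)
  obtain ⟨u0, hu0, hmax⟩ := (isCompact_sphere (0 : EuclideanSpace ℝ (Fin m)) 1).exists_isMaxOn
    ⟨u, by simpa using hu⟩ hc.continuousOn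
  have hu0' : ‖u0‖ = 1 := by simpa using hu0
  set B := dirNorm ν k (columnMap ω u0)
  have hB : ∀ v, dirNorm ν k (columnMap ω v) ≤ ‖v‖ * B := by
    intro v
    rcases eq_or_ne v 0 with rfl | hv
    · have := dirNorm_smul (ν := ν) hk 0 (0 : EuclideanSpace ℝ (Fin n))
      simp at this
      simp [this]
    · have hv0 : 0 < ‖v‖ := norm_pos_iff.2 hv
      have h1 : v = ‖v‖ • (‖v‖⁻¹ • v) := by rw [smul_smul, mul_inv_cancel₀ hv0.ne', one_smul]
      have h2 : dirNorm ν k (columnMap ω (‖v‖⁻¹ • v)) ≤ B := hmax (by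
        simp [norm_smul, inv_mul_cancel₀ hv0.ne'])
      conv_lhs => rw [h1, map_smul, dirNorm_smul hk, abs_norm]
      gcongr
  have key : ∀ v : EuclideanSpace ℝ (Fin m), ‖v‖ = 1 → ∃ c ∈ s,
      |dirNorm ν k (columnMap ω v) - dirNorm ν k (columnMap ω c)| ≤ B / 32 := by
    intro v hv
    obtain ⟨c, hcs, hvc⟩ := hs v hv
    refine ⟨c, hcs, (h.abs_dirNorm_sub_le hk _ _).trans ?_⟩
    rw [← map_sub]
    have hB0 : 0 ≤ B := dirNorm_nonneg _ _
    have := hB (v - c)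
    nlinarith
  obtain ⟨c, hcs, h1⟩ := key u0 hu0'
  obtain ⟨d, hds, h2⟩ := key u hu
  have h3 := (hω c hcs).2
  have h4 := (hω d hds).1
  have h5 := abs_le.1 h1
  have h6 := abs_le.1 h2
  have hB0 : 0 ≤ B := dirNorm_nonneg _ _
  linarith [h5.1, h5.2, h6.1, h6.2]

theorem LogConcaveMeasure.le_of_lintegral_dirNorm_pow (h : LogConcaveMeasure ν) {m : ℕ}
    (hm : 2 ≤ m) (heven : Even m) {s R : ℝ} (hs : 0 < s) (hR : 0 < R)
    (hN : ∀ u, dirNorm ν m u ≤ s * ‖u‖) (h2 : ∫ x, ‖x‖ ^ 2 ∂ν ≤ R ^ 2) {W : ℝ}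
    (hW : ∫⁻ x, ENNReal.ofReal (dirNorm ν m x ^ m) ∂(stdGaussian (EuclideanSpace ℝ (Fin n))) =
      ENNReal.ofReal (W ^ m)) (hWs : 120 * s * √m < W) : W ≤ 23136 * √m * R := by
  have hbad := h.real_dirNorm_notMem_Ioo_le hm heven hs hN hW hWs
  have hm1 : 1 ≤ m := by omega
  have hm0 : (1 : ℝ) ≤ m := by exact_mod_cast hm1
  have hsm : 0 < √(m : ℝ) := Real.sqrt_pos.2 (by linarith)
  have hsq : √(m : ℝ) ^ 2 = m := Real.sq_sqrt (by positivity)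
  have hcN := h.continuous_dirNorm hm1 heven
  obtain ⟨net, hcard, hunit, hnet⟩ := exists_sphere_net m
  set G := stdGaussian (PiLp 2 fun _ : Fin m => EuclideanSpace ℝ (Fin n)) with hG
  set bad : Set (EuclideanSpace ℝ (Fin n)) :=
    {x | ¬(W / 4 < dirNorm ν m x ∧ dirNorm ν m x < 3 * W)} with hbadset
  have hbadm : MeasurableSet bad :=
    ((measurableSet_lt measurable_const hcN.measurable).inter
      (measurableSet_lt hcN.measurable measurable_const)).compl
  set A1 : Set (PiLp 2 fun _ : Fin m => EuclideanSpace ℝ (Fin n)) :=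
    ⋃ c ∈ net, (fun ω => columnMap ω c) ⁻¹' bad
  have hA1 : G.real A1 ≤ 1 / 4 := by
    calc G.real A1 ≤ ∑ c ∈ net, G.real ((fun ω => columnMap ω c) ⁻¹' bad) :=
          measureReal_biUnion_finset_le _ _
      _ ≤ ∑ c ∈ net, 8 * (1 / 2000 : ℝ) ^ m := by
          refine Finset.sum_le_sum fun c hc => ?_
          rw [← map_measureReal_apply (continuous_columnMap_left c).measurable hbadm, hG,
            map_columnMap_stdGaussian (hunit c hc)]
          exact hbad
      _ = net.card * (8 * (1 / 2000 : ℝ) ^ m) := by rw [Finset.sum_const, nsmul_eq_mul]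
      _ ≤ 65 ^ m * (8 * (1 / 2000 : ℝ) ^ m) := by
          gcongr
          exact_mod_cast hcard
      _ = 8 * (65 / 2000 : ℝ) ^ m := by rw [div_pow, div_pow]; ring
      _ ≤ 8 * (65 / 2000 : ℝ) ^ 2 := by
          gcongr 8 * ?_
          exact pow_le_pow_of_le_one (by norm_num) (by norm_num) hm
      _ ≤ 1 / 4 := by norm_num
  set F : (PiLp 2 fun _ : Fin m => EuclideanSpace ℝ (Fin n)) → ℝ≥0∞ :=
    fun ω => ∫⁻ x, ENNReal.ofReal (‖rowMap ω x‖ ^ 2) ∂ν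
  have hrow : Measurable fun z : (PiLp 2 fun _ : Fin m => EuclideanSpace ℝ (Fin n)) ×
      EuclideanSpace ℝ (Fin n) => ENNReal.ofReal (‖rowMap z.1 z.2‖ ^ 2) := by
    simp_rw [EuclideanSpace.norm_sq_eq, rowMap_apply]
    fun_prop
  have hF : ∫⁻ ω, F ω ∂G ≤ ENNReal.ofReal (m * R ^ 2) := by
    rw [lintegral_lintegral_swap hrow.aemeasurable]
    simp_rw [hG, lintegral_norm_rowMap_sq]
    rw [← ofReal_integral_eq_lintegral_ofReal ((h.integrable_norm_pow (m := 2)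
      (by norm_num)).const_mul _) (Filter.Eventually.of_forall fun x => by positivity),
      integral_const_mul]
    gcongr
  set A2 : Set (PiLp 2 fun _ : Fin m => EuclideanSpace ℝ (Fin n)) :=
    {ω | ENNReal.ofReal (2 * (m * R ^ 2)) ≤ F ω}
  have hA2 : G.real A2 ≤ 1 / 2 := by
    have h3 := (mul_meas_ge_le_lintegral (μ := G) (hrow.lintegral_prod_right')
      (ENNReal.ofReal (2 * (m * R ^ 2)))).trans hF
    rw [← ofReal_measureReal, ← ENNReal.ofReal_mul (by positivity),
      ENNReal.ofReal_le_ofReal_iff (by positivity)] at h3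
    have h4 : 0 < m * R ^ 2 := by positivity
    have h5 : (m * R ^ 2) * (2 * G.real A2) ≤ (m * R ^ 2) * 1 := by
      rw [mul_one]
      calc _ = 2 * (m * R ^ 2) * G.real A2 := by ring
        _ ≤ _ := h3
    linarith [le_of_mul_le_mul_left h5 h4]
  obtain ⟨ω, hω⟩ : ∃ ω, ω ∉ A1 ∪ A2 := by
    by_contra! hcon
    have h3 : G.real (A1 ∪ A2) = 1 := by
      rw [Set.eq_univ_of_forall hcon]; simp
    have := measureReal_union_le (μ := G) A1 A2
    linarith
  simp only [Set.mem_union, not_or] at hω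
  have hω1 : ∀ c ∈ net, W / 4 < dirNorm ν m (columnMap ω c) ∧
      dirNorm ν m (columnMap ω c) < 3 * W := by
    intro c hc
    by_contra hcon
    exact hω.1 (Set.mem_biUnion hc hcon)
  have hω2 : F ω < ENNReal.ofReal (2 * (m * R ^ 2)) := not_le.1 hω.2
  have hρ : 0 < 2 * √m * R := by positivity
  have hprob : IsProbabilityMeasure (ν.map (rowMap ω)) :=
    Measure.isProbabilityMeasure_map (by fun_prop)
  have hball : 1 / 2 ≤ (ν.map (rowMap ω)).real (Metric.closedBall 0 (2 * √m * R)) := by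
    rw [map_measureReal_apply (by fun_prop) Metric.isClosed_closedBall.measurableSet]
    have h3 := (mul_meas_ge_le_lintegral (μ := ν)
      (f := fun x => ENNReal.ofReal (‖rowMap ω x‖ ^ 2)) (by fun_prop)
      (ENNReal.ofReal ((2 * √m * R) ^ 2))).trans hω2.le
    have h4 : (rowMap ω ⁻¹' Metric.closedBall 0 (2 * √m * R))ᶜ ⊆
        {x | ENNReal.ofReal ((2 * √m * R) ^ 2) ≤ ENNReal.ofReal (‖rowMap ω x‖ ^ 2)} := by
      intro x hx
      have hx' : 2 * √m * R < ‖rowMap ω x‖ := by simpa using hx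
      exact ENNReal.ofReal_le_ofReal (pow_le_pow_left₀ hρ.le hx'.le 2)
    have h5 := (mul_le_mul_right (measure_mono (μ := ν) h4) _).trans h3
    rw [← ofReal_measureReal, ← ENNReal.ofReal_mul (by positivity),
      ENNReal.ofReal_le_ofReal_iff (by positivity), mul_pow, mul_pow, hsq,
      probReal_compl_eq_one_sub ((rowMap ω).continuous.measurable
        Metric.isClosed_closedBall.measurableSet)] at h5
    have h6 : 0 < m * R ^ 2 := by positivity
    nlinarith
  obtain ⟨u, hu, hmom⟩ := (h.map (rowMap ω)).exists_integral_rpow_le hm1 hρ hball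
  have h3 := h.le_dirNorm_columnMap hm1 heven hnet ω hω1 hu
  simp only [Real.rpow_natCast] at hmom
  rw [integral_map (by fun_prop) (Continuous.aestronglyMeasurable (by fun_prop))] at hmom
  simp only [inner_rowMap] at hmom
  rw [← dirNorm_pow hm1] at hmom
  have h4 := le_of_pow_le_pow_left₀ (by omega) (by positivity) hmom
  linarith

/-- **Paouris' inequality** for even moments. -/
theorem LogConcaveMeasure.integral_norm_pow_le (h : LogConcaveMeasure ν) {m : ℕ}
    (hm : 2 ≤ m) (heven : Even m) {s R : ℝ} (hs : 0 < s) (hR : 0 < R)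
    (hN : ∀ u, dirNorm ν m u ≤ s * ‖u‖) (h2 : ∫ x, ‖x‖ ^ 2 ∂ν ≤ R ^ 2) :
    ∫ x, ‖x‖ ^ m ∂ν ≤ (400000 * (R + s)) ^ m := by
  have hm1 : 1 ≤ m := by omega
  have hm0 : (1 : ℝ) ≤ m := by exact_mod_cast hm1
  have hsm : 0 < √(m : ℝ) := Real.sqrt_pos.2 (by linarith)
  have hg := le_gaussMoment hm
  have hg0 : 0 ≤ gaussMoment m := le_trans (by positivity) hg
  set M := ∫ x, ‖x‖ ^ m ∂ν with hM
  have hM0 : 0 ≤ M := integral_nonneg fun _ => by positivity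
  set W := (gaussMoment m * M) ^ ((m : ℝ)⁻¹) with hWdef
  have hWm : W ^ m = gaussMoment m * M := Real.rpow_inv_natCast_pow (by positivity) (by omega)
  have hW := h.lintegral_dirNorm_pow hm1
  rw [← hM, ← hWm] at hW
  have hW0 : 0 ≤ W := by positivity
  have h3 : W ≤ 23136 * √m * (R + s) := by
    rcases le_or_gt W (120 * s * √m) with hc | hc
    · have : 0 < s * √m := by positivity
      have : 0 < R * √m := by positivity
      linarith
    · have := h.le_of_lintegral_dirNorm_pow hm heven hs hR hN h2 hW hc
      have : 0 < s * √m := by positivity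
      linarith
  have h4 : (√m / 16) ^ m * M ≤ (√m / 16) ^ m * (370176 * (R + s)) ^ m := by
    calc (√m / 16) ^ m * M ≤ gaussMoment m * M := by gcongr
      _ = W ^ m := hWm.symm
      _ ≤ (23136 * √m * (R + s)) ^ m := pow_le_pow_left₀ hW0 h3 m
      _ = _ := by rw [← mul_pow]; congr 1; ring
  refine (le_of_mul_le_mul_left h4 (by positivity)).trans ?_
  gcongr
  norm_num

end Paouris

section Coordinates

variable {n : ℕ} {ν : Measure (EuclideanSpace ℝ (Fin n))} [IsProbabilityMeasure ν]

/-- The coordinate projection of `ℝⁿ` onto the coordinates in `I`. -/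
def coordProj (I : Finset (Fin n)) : EuclideanSpace ℝ (Fin n) →L[ℝ] EuclideanSpace ℝ (Fin n) :=
  (EuclideanSpace.equiv (Fin n) ℝ).symm.toContinuousLinearMap ∘L
    ContinuousLinearMap.pi fun i => if i ∈ I then EuclideanSpace.proj i else 0

theorem coordProj_apply (I : Finset (Fin n)) (x : EuclideanSpace ℝ (Fin n)) (i : Fin n) :
    coordProj I x i = if i ∈ I then x i else 0 := by
  by_cases hi : i ∈ I <;> simp [coordProj, hi]

theorem norm_coordProj_sq (I : Finset (Fin n)) (x : EuclideanSpace ℝ (Fin n)) :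
    ‖coordProj I x‖ ^ 2 = ∑ i ∈ I, x i ^ 2 := by
  rw [EuclideanSpace.norm_sq_eq]
  simp [coordProj_apply, ite_pow]

theorem norm_coordProj_le (I : Finset (Fin n)) (x : EuclideanSpace ℝ (Fin n)) :
    ‖coordProj I x‖ ≤ ‖x‖ := by
  refine (pow_le_pow_iff_left₀ (norm_nonneg _) (norm_nonneg _) two_ne_zero).1 ?_
  rw [norm_coordProj_sq, EuclideanSpace.norm_sq_eq]
  simp only [Real.norm_eq_abs, sq_abs]
  exact Finset.sum_le_sum_of_subset_of_nonneg (Finset.subset_univ _) fun _ _ _ => sq_nonneg _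

theorem inner_coordProj (I : Finset (Fin n)) (u x : EuclideanSpace ℝ (Fin n)) :
    ⟪u, coordProj I x⟫ = ⟪coordProj I u, x⟫ := by
  simp only [PiLp.inner_apply, coordProj_apply]
  refine Finset.sum_congr rfl fun i _ => ?_
  split_ifs <;> simp

theorem LogConcaveMeasure.integrable_norm_clm_pow (h : LogConcaveMeasure ν)
    (f : EuclideanSpace ℝ (Fin n) →L[ℝ] EuclideanSpace ℝ (Fin n)) {k : ℕ} (hk : 1 ≤ k) :
    Integrable (fun x => ‖f x‖ ^ k) ν := by
  have : IsProbabilityMeasure (ν.map f) := Measure.isProbabilityMeasure_map (by fun_prop)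
  exact (integrable_map_measure (g := fun x => ‖x‖ ^ k)
    (Continuous.aestronglyMeasurable (by fun_prop))
    (by fun_prop)).1 ((h.map f).integrable_norm_pow hk)

theorem LogConcaveMeasure.integrable_coord_sq (h : LogConcaveMeasure ν) (i : Fin n) :
    Integrable (fun x => x i ^ 2) ν := by
  have := h.integrable_inner_pow (m := 2) (by norm_num) (EuclideanSpace.single i 1)
  simpa [EuclideanSpace.inner_single_left] using this

theorem LogConcaveMeasure.dirNorm_le_of_integral_rpow_le (h : LogConcaveMeasure ν) {p σ : ℝ}
    (hp : 1 ≤ p) (hσ : 0 < σ)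
    (hmom : ∀ u : EuclideanSpace ℝ (Fin n), ‖u‖ = 1 → ∫ x, |⟪u, x⟫| ^ p ∂ν ≤ σ ^ p) {m : ℕ}
    (hm : p ≤ m) (u : EuclideanSpace ℝ (Fin n)) : dirNorm ν m u ≤ 126 * σ * m / p * ‖u‖ := by
  have hm1 : 1 ≤ m := by exact_mod_cast hp.trans hm
  rcases eq_or_ne u 0 with rfl | hu
  · have := dirNorm_smul (ν := ν) hm1 0 (0 : EuclideanSpace ℝ (Fin n))
    simp at this
    simp [this]
  have hu0 : 0 < ‖u‖ := norm_pos_iff.2 hu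
  have hn : ‖‖u‖⁻¹ • u‖ = 1 := by rw [norm_smul, norm_inv, norm_norm, inv_mul_cancel₀ hu0.ne']
  have h1 := h.integral_rpow_le_of_integral_rpow_le (innerSL ℝ (‖u‖⁻¹ • u)) hσ hp hm
    (by simpa only [innerSL_apply_apply] using hmom _ hn)
  simp only [innerSL_apply_apply, Real.rpow_natCast] at h1
  rw [← dirNorm_pow hm1] at h1
  have h2 := le_of_pow_le_pow_left₀ (by omega) (by positivity) h1
  have h3 : u = ‖u‖ • (‖u‖⁻¹ • u) := by rw [smul_smul, mul_inv_cancel₀ hu0.ne', one_smul]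
  conv_lhs => rw [h3, dirNorm_smul hm1, abs_norm]
  rw [mul_comm]
  gcongr

/-- Moments of coordinate projections of isotropic log-concave measures. -/
theorem LogConcaveMeasure.integral_sum_sq_pow_le (h : LogConcaveMeasure ν)
    (hiso : ∀ i, ∫ x, x i ^ 2 ∂ν = 1) {p σ : ℝ} (hp : 1 ≤ p) (hσ : 0 < σ)
    (hmom : ∀ u : EuclideanSpace ℝ (Fin n), ‖u‖ = 1 → ∫ x, |⟪u, x⟫| ^ p ∂ν ≤ σ ^ p)
    {I : Finset (Fin n)} (hI : I.Nonempty) {r : ℕ} (hr : 1 ≤ r) (hpr : p ≤ r) :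
    ∫ x, (∑ i ∈ I, x i ^ 2) ^ r ∂ν ≤ ((400000 * (√I.card + 252 * σ * r / p)) ^ 2) ^ r := by
  have : IsProbabilityMeasure (ν.map (coordProj I)) :=
    Measure.isProbabilityMeasure_map (by fun_prop)
  have hr0 : (1 : ℝ) ≤ r := by exact_mod_cast hr
  have hp0 : 0 < p := by linarith
  have hc : (0 : ℝ) < I.card := by exact_mod_cast hI.card_pos
  have h1 := (h.map (coordProj I)).integral_norm_pow_le (m := 2 * r) (s := 252 * σ * r / p)
    (R := √I.card) (by omega) (even_two_mul r) (by positivity) (by positivity) ?_ ?_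
  · rw [integral_map (by fun_prop) (Continuous.aestronglyMeasurable (by fun_prop))] at h1
    simp only [pow_mul, norm_coordProj_sq] at h1
    exact h1
  · intro u
    have h2 : dirNorm (ν.map (coordProj I)) (2 * r) u = dirNorm ν (2 * r) (coordProj I u) := by
      rw [dirNorm, dirNorm,
        integral_map (by fun_prop) (Continuous.aestronglyMeasurable (by fun_prop))]
      simp only [inner_coordProj]
    rw [h2]
    refine (h.dirNorm_le_of_integral_rpow_le hp hσ hmom (m := 2 * r) (by push_cast; linarith)
      _).trans ?_
    have h3 := norm_coordProj_le I u
    calc 126 * σ * ((2 * r : ℕ) : ℝ) / p * ‖coordProj I u‖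
        = 252 * σ * r / p * ‖coordProj I u‖ := by push_cast; ring
      _ ≤ _ := by gcongr
  · rw [integral_map (by fun_prop) (Continuous.aestronglyMeasurable (by fun_prop))]
    simp only [norm_coordProj_sq]
    rw [integral_finsetSum _ fun i _ => h.integrable_coord_sq i, Real.sq_sqrt (by positivity)]
    simp [hiso]

theorem LogConcaveMeasure.sum_integral_cond_sq_le (h : LogConcaveMeasure ν)
    (hiso : ∀ i, ∫ x, x i ^ 2 ∂ν = 1) {p σ : ℝ} (hp : 1 ≤ p) (hσ : 0 < σ)
    (hmom : ∀ u : EuclideanSpace ℝ (Fin n), ‖u‖ = 1 → ∫ x, |⟪u, x⟫| ^ p ∂ν ≤ σ ^ p)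
    (I : Finset (Fin n)) {r : ℕ} (hr : 1 ≤ r) (hpr : p ≤ r)
    {A : Set (EuclideanSpace ℝ (Fin n))} (hA : MeasurableSet A) (hAc : Convex ℝ A)
    (hAr : exp (-(r : ℝ)) ≤ ν.real A) :
    ∑ i ∈ I, ∫ x, x i ^ 2 ∂(ν[|A]) ≤ 10 ^ 12 * (I.card + (252 * σ * r / p) ^ 2) := by
  have hp0 : 0 < p := by linarith
  rcases I.eq_empty_or_nonempty with rfl | hI
  · simp only [Finset.sum_empty, Finset.card_empty, Nat.cast_zero, zero_add]
    positivity
  have hA0 : 0 < ν.real A := (exp_pos _).trans_le hAr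
  have hA0' : ν A ≠ 0 := fun h0 => by simp [measureReal_def, h0] at hA0
  have hprob : IsProbabilityMeasure (ν[|A]) := cond_isProbabilityMeasure hA0'
  have hcond := h.cond hA hAc hA0'
  have hint : ∀ (ν' : Measure (EuclideanSpace ℝ (Fin n))) [IsProbabilityMeasure ν'],
      LogConcaveMeasure ν' → ∀ k : ℕ, 1 ≤ k →
        Integrable (fun x => (∑ i ∈ I, x i ^ 2) ^ k) ν' := by
    intro ν' _ h' k hk
    have := h'.integrable_norm_clm_pow (coordProj I) (k := 2 * k) (by omega)
    simpa only [pow_mul, norm_coordProj_sq] using this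
  set s := 252 * σ * r / p
  have h1 : (∫ x, ∑ i ∈ I, x i ^ 2 ∂(ν[|A])) ^ r ≤ ∫ x, (∑ i ∈ I, x i ^ 2) ^ r ∂(ν[|A]) := by
    refine (convexOn_pow r).map_integral_le (continuous_pow r).continuousOn isClosed_Ici
      (Filter.Eventually.of_forall fun x =>
        Set.mem_Ici.2 (Finset.sum_nonneg fun i _ => sq_nonneg (x i))) ?_ ?_
    · simpa using hint _ hcond 1 le_rfl
    · exact hint _ hcond r hr
  have h2 : ∫ x, (∑ i ∈ I, x i ^ 2) ^ r ∂(ν[|A]) ≤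
      (exp 1 * (400000 * (√I.card + s)) ^ 2) ^ r := by
    rw [ProbabilityTheory.cond, integral_smul_measure, ENNReal.toReal_inv,
      ← measureReal_def, smul_eq_mul, mul_pow, ← Real.exp_nat_mul, mul_one]
    have h3 : (ν.real A)⁻¹ ≤ exp r := by
      rw [inv_le_comm₀ hA0 (exp_pos _), ← Real.exp_neg]
      exact hAr
    have h4 : ∫ x in A, (∑ i ∈ I, x i ^ 2) ^ r ∂ν ≤ ∫ x, (∑ i ∈ I, x i ^ 2) ^ r ∂ν :=
      setIntegral_le_integral (hint _ h r hr) (Filter.Eventually.of_forall fun x => by positivity)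
    have h5 := h4.trans (h.integral_sum_sq_pow_le hiso hp hσ hmom hI hr hpr)
    have h6 : 0 ≤ ∫ x in A, (∑ i ∈ I, x i ^ 2) ^ r ∂ν := integral_nonneg fun x => by positivity
    exact mul_le_mul h3 h5 h6 (exp_pos _).le
  have h3 := le_of_pow_le_pow_left₀ (by omega) (by positivity) (h1.trans h2)
  rw [integral_finsetSum _ fun i _ => hcond.integrable_coord_sq i] at h3
  refine h3.trans ?_
  have h4 : exp 1 ≤ 3 := by linarith [Real.exp_one_lt_d9]
  have hsq : √(I.card : ℝ) ^ 2 = I.card := Real.sq_sqrt (by positivity)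
  have h5 : (√(I.card : ℝ) + s) ^ 2 ≤ 2 * (I.card + s ^ 2) := by
    nlinarith [sq_nonneg (√(I.card : ℝ) - s)]
  have h6 : 0 ≤ (I.card : ℝ) + s ^ 2 := by positivity
  calc exp 1 * (400000 * (√I.card + s)) ^ 2 ≤ 3 * (400000 * (√I.card + s)) ^ 2 := by gcongr
    _ = 3 * 400000 ^ 2 * (√I.card + s) ^ 2 := by ring
    _ ≤ 3 * 400000 ^ 2 * (2 * (I.card + s ^ 2)) := by gcongr
    _ ≤ _ := by nlinarith

end Coordinates

section DyadicTails

variable {n : ℕ} {ν : Measure (EuclideanSpace ℝ (Fin n))} [IsProbabilityMeasure ν]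

theorem LogConcaveMeasure.real_coord_tail_le (h : LogConcaveMeasure ν) (i : Fin n) {β : ℝ}
    (hβ : 0 < β) (h2 : ∫ x, x i ^ 2 ∂ν ≤ β ^ 2) (y : ℝ) :
    ν.real {x | y ≤ |x i|} ≤ exp (1 - y / (5 * β)) := by
  rcases le_total (y / (5 * β)) 1 with hc | hc
  · exact measureReal_le_one.trans (Real.one_le_exp (by linarith))
  have h3 := mul_meas_ge_le_integral_of_nonneg
    (Filter.Eventually.of_forall fun x : EuclideanSpace ℝ (Fin n) => sq_nonneg (x i))
    (h.integrable_coord_sq i) ((5 * β) ^ 2)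
  have h4 : ν.real {x | 5 * β ≤ |(EuclideanSpace.proj (𝕜 := ℝ) i :
      EuclideanSpace ℝ (Fin n) →L[ℝ] ℝ) x|} ≤ exp (-3 * 1) := by
    have h5 : {x : EuclideanSpace ℝ (Fin n) | 5 * β ≤ |x i|} ⊆ {x | (5 * β) ^ 2 ≤ x i ^ 2} := by
      intro x hx
      have hx' : 5 * β ≤ |x i| := hx
      have := pow_le_pow_left₀ (by positivity) hx' 2
      rwa [sq_abs] at this
    have h6 := measureReal_mono (μ := ν) h5
    have h7 : ν.real {x | (5 * β) ^ 2 ≤ x i ^ 2} ≤ 1 / 25 := by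
      have h8 : β ^ 2 * (25 * ν.real {x | (5 * β) ^ 2 ≤ x i ^ 2}) ≤ β ^ 2 * 1 := by
        calc _ = (5 * β) ^ 2 * ν.real {x | (5 * β) ^ 2 ≤ x i ^ 2} := by ring
          _ ≤ _ := by rw [mul_one]; exact h3.trans h2
      linarith [le_of_mul_le_mul_left h8 (by positivity)]
    have h9 : (1 / 25 : ℝ) ≤ exp (-3 * 1) := by
      rw [mul_one, Real.exp_neg, one_div, inv_le_inv₀ (by norm_num) (exp_pos _),
        show (3 : ℝ) = ((3 : ℕ) : ℝ) * 1 by norm_num, Real.exp_nat_mul]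
      have := Real.exp_one_lt_d9
      calc exp 1 ^ 3 ≤ 2.7182818286 ^ 3 := by gcongr
        _ ≤ 25 := by norm_num
    exact (h6.trans h7).trans h9
  have h5 := h.tail_le (EuclideanSpace.proj (𝕜 := ℝ) i) (by positivity) le_rfl h4 hc
  rw [div_mul_cancel₀ _ (by positivity)] at h5
  refine h5.trans (Real.exp_le_exp.2 (by linarith))

theorem four_mul_sq_mul_exp_le {a y : ℝ} (ha : 0 < a) (hy : 0 ≤ y) :
    4 * y ^ 2 * exp ((1 - y / a) / 2) ≤
      256 * a ^ 2 * (exp (-(y / (4 * a))) - exp (-(2 * y / (4 * a)))) := by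
  set z := y / (4 * a) with hz
  have hz0 : 0 ≤ z := by positivity
  have hyz : y = 4 * a * z := by rw [hz]; field_simp
  have h1 : exp ((1 - y / a) / 2) = exp (1 / 2) * exp (-(2 * z)) := by
    rw [← Real.exp_add]; congr 1; rw [hyz]; field_simp; ring
  have h2 : 2 * y / (4 * a) = 2 * z := by rw [hyz]; field_simp
  have h3 : exp (1 / 2) ≤ 2 := by
    refine le_of_pow_le_pow_left₀ two_ne_zero (by norm_num) ?_
    rw [← Real.exp_nat_mul]
    norm_num
    linarith [Real.exp_one_lt_d9]
  have h4 : exp (-z) = exp (-(2 * z)) * exp z := by rw [← Real.exp_add]; congr 1; ring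
  have h5 := Real.quadratic_le_exp_of_nonneg hz0
  rw [h1, h2, h4, hyz]
  calc 4 * (4 * a * z) ^ 2 * (exp (1 / 2) * exp (-(2 * z)))
      ≤ 4 * (4 * a * z) ^ 2 * (2 * exp (-(2 * z))) := by gcongr
    _ = 128 * a ^ 2 * exp (-(2 * z)) * z ^ 2 := by ring
    _ ≤ 128 * a ^ 2 * exp (-(2 * z)) * (2 * (exp z - 1)) := by gcongr; linarith
    _ = _ := by ring

theorem LogConcaveMeasure.tsum_dyadic_le (h : LogConcaveMeasure ν) (i : Fin n) {β t : ℝ}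
    (hβ : 0 < β) (ht : 0 < t) (h2 : ∫ x, x i ^ 2 ∂ν ≤ β ^ 2) :
    ∑' k : ℕ, ENNReal.ofReal (4 * (2 ^ k * t) ^ 2) *
      ν {x | 2 ^ k * t ≤ |x i|} ^ (1 / 2 : ℝ) ≤
      ENNReal.ofReal (6400 * β ^ 2 * exp (-(t / (20 * β)))) := by
  set f : ℕ → ℝ := fun k => 6400 * β ^ 2 * exp (-(2 ^ k * t / (20 * β))) with hf
  have hterm : ∀ k : ℕ, ENNReal.ofReal (4 * (2 ^ k * t) ^ 2) *
      ν {x | 2 ^ k * t ≤ |x i|} ^ (1 / 2 : ℝ) ≤ ENNReal.ofReal (f k - f (k + 1)) := by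
    intro k
    have h3 := h.real_coord_tail_le i hβ h2 (2 ^ k * t)
    rw [← ofReal_measureReal, ENNReal.ofReal_rpow_of_nonneg measureReal_nonneg (by norm_num),
      ← ENNReal.ofReal_mul (by positivity)]
    refine ENNReal.ofReal_le_ofReal ?_
    have h4 := four_mul_sq_mul_exp_le (a := 5 * β) (y := 2 ^ k * t) (by positivity) (by positivity)
    calc 4 * (2 ^ k * t) ^ 2 * ν.real {x | 2 ^ k * t ≤ |x i|} ^ (1 / 2 : ℝ)
        ≤ 4 * (2 ^ k * t) ^ 2 * exp (1 - 2 ^ k * t / (5 * β)) ^ (1 / 2 : ℝ) := by gcongr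
      _ = 4 * (2 ^ k * t) ^ 2 * exp ((1 - 2 ^ k * t / (5 * β)) / 2) := by
          rw [← Real.exp_mul]; congr 2; ring
      _ ≤ _ := h4
      _ = f k - f (k + 1) := by
          rw [hf]; simp only [pow_succ]; ring_nf
  refine (ENNReal.tsum_le_tsum hterm).trans ?_
  have hanti : ∀ k, 0 ≤ f k - f (k + 1) := by
    intro k
    rw [hf, sub_nonneg]
    simp only
    gcongr
    · norm_num
    · omega
  refine ENNReal.tsum_le_of_sum_range_le fun N => ?_
  rw [← ENNReal.ofReal_sum_of_nonneg fun k _ => hanti k, Finset.sum_range_sub']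
  refine ENNReal.ofReal_le_ofReal ?_
  have h0 : 0 ≤ f N := by positivity
  have h00 : f 0 = 6400 * β ^ 2 * exp (-(t / (20 * β))) := by simp [hf]
  linarith

/-- The half-spaces `{± x i ≥ 2 ^ k * t}`. -/
def dyadicHalfSpace (t : ℝ) (j : Fin n × ℕ × Bool) : Set (EuclideanSpace ℝ (Fin n)) :=
  {x | 2 ^ j.2.1 * t ≤ (if j.2.2 then 1 else -1) * x j.1}

/-- The weight attached to the dyadic level `k`. -/
def dyadicWeight (t : ℝ) (j : Fin n × ℕ × Bool) : ℝ≥0∞ := ENNReal.ofReal (4 * (2 ^ j.2.1 * t) ^ 2)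

theorem measurableSet_dyadicHalfSpace (t : ℝ) (j : Fin n × ℕ × Bool) :
    MeasurableSet (dyadicHalfSpace t j) :=
  measurableSet_le measurable_const (by fun_prop)

theorem convex_dyadicHalfSpace (t : ℝ) (j : Fin n × ℕ × Bool) :
    Convex ℝ (dyadicHalfSpace t j) := by
  refine convex_halfSpace_ge (f := fun x : EuclideanSpace ℝ (Fin n) =>
    (if j.2.2 then 1 else -1) * x j.1) ⟨fun x y => ?_, fun c x => ?_⟩ _
  · simp [mul_add]
  · simp

theorem dyadicHalfSpace_subset (t : ℝ) (j : Fin n × ℕ × Bool) :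
    dyadicHalfSpace t j ⊆ {x | 2 ^ j.2.1 * t ≤ |x j.1|} := by
  intro x hx
  refine (show 2 ^ j.2.1 * t ≤ (if j.2.2 then 1 else -1) * x j.1 from hx).trans ?_
  split_ifs
  · rw [one_mul]; exact le_abs_self _
  · rw [neg_one_mul]; exact neg_le_abs _

theorem LogConcaveMeasure.tsum_dyadicWeight_le (h : LogConcaveMeasure ν) {t : ℝ} (ht : 0 < t)
    (β : Fin n → ℝ) (hβ : ∀ i, 0 < β i) (h2 : ∀ i, ∫ x, x i ^ 2 ∂ν ≤ β i ^ 2) :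
    ∑' j : Fin n × ℕ × Bool, dyadicWeight t j * ν (dyadicHalfSpace t j) ^ (1 / 2 : ℝ) ≤
      ENNReal.ofReal (∑ i, 12800 * β i ^ 2 * exp (-(t / (20 * β i)))) := by
  calc ∑' j : Fin n × ℕ × Bool, dyadicWeight t j * ν (dyadicHalfSpace t j) ^ (1 / 2 : ℝ)
      ≤ ∑' j : Fin n × ℕ × Bool, ENNReal.ofReal (4 * (2 ^ j.2.1 * t) ^ 2) *
          ν {x | 2 ^ j.2.1 * t ≤ |x j.1|} ^ (1 / 2 : ℝ) := by
        refine ENNReal.tsum_le_tsum fun j => ?_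
        have := dyadicHalfSpace_subset t j
        unfold dyadicWeight
        gcongr
    _ = ∑ i, ∑' k : ℕ, 2 * (ENNReal.ofReal (4 * (2 ^ k * t) ^ 2) *
          ν {x | 2 ^ k * t ≤ |x i|} ^ (1 / 2 : ℝ)) := by
        rw [ENNReal.tsum_prod', tsum_fintype]
        refine Finset.sum_congr rfl fun i _ => ?_
        rw [ENNReal.tsum_prod']
        refine tsum_congr fun k => ?_
        rw [tsum_fintype, Fintype.sum_bool, two_mul]
    _ ≤ ∑ i, 2 * ENNReal.ofReal (6400 * β i ^ 2 * exp (-(t / (20 * β i)))) := by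
        refine Finset.sum_le_sum fun i _ => ?_
        rw [ENNReal.tsum_mul_left]
        gcongr
        exact h.tsum_dyadic_le i (hβ i) ht (h2 i)
    _ = _ := by
        rw [ENNReal.ofReal_sum_of_nonneg fun i _ => by positivity]
        refine Finset.sum_congr rfl fun i _ => ?_
        rw [show (2 : ℝ≥0∞) = ENNReal.ofReal 2 by norm_num, ← ENNReal.ofReal_mul (by norm_num)]
        congr 1
        ring

end DyadicTails

section ConditionalSums

variable {n : ℕ} {ν : Measure (EuclideanSpace ℝ (Fin n))} [IsProbabilityMeasure ν]

theorem sq_one_add_le_exp {y : ℝ} (hy : 0 ≤ y) : (1 + y) ^ 2 ≤ 64 * exp (y / 4) := by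
  have h1 := Real.add_one_le_exp (y / 8)
  have h2 : exp (y / 4) = exp (y / 8) ^ 2 := by
    rw [← Real.exp_nat_mul]; congr 1; push_cast; ring
  rw [h2]
  have h3 : (1 + y) ^ 2 ≤ (8 * exp (y / 8)) ^ 2 := pow_le_pow_left₀ (by linarith) (by linarith) 2
  linarith

theorem LogConcaveMeasure.tsum_cond_dyadicWeight_le (h : LogConcaveMeasure ν)
    (hiso : ∀ i, ∫ x, x i ^ 2 ∂ν = 1) {p σ t : ℝ} (hp : 1 ≤ p) (hσ : 0 < σ)
    (hmom : ∀ u : EuclideanSpace ℝ (Fin n), ‖u‖ = 1 → ∫ x, |⟪u, x⟫| ^ p ∂ν ≤ σ ^ p)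
    (ht : 0 < t) (hnt : n * exp (-(t / (3 * 10 ^ 7))) ≤ σ ^ 2)
    {A : Set (EuclideanSpace ℝ (Fin n))} (hA : MeasurableSet A) (hAc : Convex ℝ A)
    (hA0 : ν A ≠ 0) :
    ∑' j : Fin n × ℕ × Bool, dyadicWeight t j * (ν[|A]) (dyadicHalfSpace t j) ^ (1 / 2 : ℝ) ≤
      ENNReal.ofReal (10 ^ 24 * σ ^ 2 * ν.real A ^ (-(1 / (4 * p)))) := by
  have hp0 : 0 < p := by linarith
  have hAr : 0 < ν.real A := ENNReal.toReal_pos hA0 (measure_ne_top _ _)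
  have hprob : IsProbabilityMeasure (ν[|A]) := cond_isProbabilityMeasure hA0
  have hcond := h.cond hA hAc hA0
  set q := -Real.log (ν.real A) with hq
  have hq0 : 0 ≤ q := by
    have := Real.log_nonpos hAr.le (measureReal_le_one (μ := ν) (s := A)); linarith
  have hAq : ν.real A = exp (-q) := by rw [hq, neg_neg, Real.exp_log hAr]
  set r := ⌈max p q⌉₊ with hr
  have hr1 : max p q ≤ r := Nat.le_ceil _
  have hpr : p ≤ r := (le_max_left _ _).trans hr1
  have hqr : q ≤ r := (le_max_right _ _).trans hr1
  have hr0 : 1 ≤ r := by exact_mod_cast hp.trans hpr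
  have hr2 : (r : ℝ) ≤ 2 * (p + q) := by
    have h1 := (Nat.ceil_lt_add_one (show 0 ≤ max p q from hp0.le.trans (le_max_left _ _))).le
    have h2 : max p q ≤ p + q := max_le (by linarith) (by linarith)
    rw [← hr] at h1
    linarith
  set s := 252 * σ * r / p with hs
  have hsle : s ≤ 504 * σ * (1 + q / p) := by
    calc s ≤ 252 * σ * (2 * (p + q)) / p := by rw [hs]; gcongr
      _ = _ := by field_simp; ring
  have hs0 : 0 ≤ s := by positivity
  have hsum := fun I => h.sum_integral_cond_sq_le hiso hp hσ hmom I hr0 hpr hA hAc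
    (by rw [hAq]; exact Real.exp_le_exp.2 (by linarith))
  set b : Fin n → ℝ := fun i => ∫ x, x i ^ 2 ∂(ν[|A]) with hb
  set I : Finset (Fin n) := Finset.univ.filter fun i => 2 * 10 ^ 12 ≤ b i with hI
  have hIsum : ∑ i ∈ I, b i ≤ 2 * 10 ^ 12 * s ^ 2 := by
    have h1 := hsum I
    have h2 : I.card * (2 * 10 ^ 12 : ℝ) ≤ ∑ i ∈ I, b i := by
      rw [← nsmul_eq_mul]
      exact Finset.card_nsmul_le_sum _ _ _ fun i hi => (Finset.mem_filter.1 hi).2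
    change ∑ i ∈ I, b i ≤ _ at h1
    linarith
  set β : Fin n → ℝ := fun i => if i ∈ I then √(b i) else 3 / 2 * 10 ^ 6 with hβ
  have hb0 : ∀ i, 0 ≤ b i := fun i => integral_nonneg fun x => sq_nonneg _
  have hβ0 : ∀ i, 0 < β i := by
    intro i
    simp only [hβ]
    split_ifs with hi
    · have := (Finset.mem_filter.1 hi).2
      exact Real.sqrt_pos.2 (by linarith)
    · norm_num
  have hβb : ∀ i, b i ≤ β i ^ 2 := by
    intro i
    simp only [hβ]
    split_ifs with hi
    · rw [Real.sq_sqrt (hb0 i)]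
    · have : b i < 2 * 10 ^ 12 := by
        by_contra! hcon
        exact hi (Finset.mem_filter.2 ⟨Finset.mem_univ _, hcon⟩)
      norm_num at this ⊢
      linarith
  refine (hcond.tsum_dyadicWeight_le ht β hβ0 hβb).trans (ENNReal.ofReal_le_ofReal ?_)
  have hterm : ∀ i, 12800 * β i ^ 2 * exp (-(t / (20 * β i))) ≤
      (if i ∈ I then 12800 * b i else 0) +
        12800 * (9 / 4 * 10 ^ 12) * exp (-(t / (3 * 10 ^ 7))) := by
    intro i
    by_cases hi : i ∈ I
    · simp only [hβ, hi, if_true]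
      rw [Real.sq_sqrt (hb0 i)]
      have h1 : exp (-(t / (20 * √(b i)))) ≤ 1 := Real.exp_le_one_iff.2 (by
        rw [neg_nonpos]; positivity)
      have h2 : 12800 * b i * exp (-(t / (20 * √(b i)))) ≤ 12800 * b i * 1 := by
        have := hb0 i; gcongr
      have h3 : 0 ≤ 12800 * (9 / 4 * 10 ^ 12) * exp (-(t / (3 * 10 ^ 7))) := by positivity
      linarith
    · simp only [hβ, hi, if_false]
      rw [show (20 : ℝ) * (3 / 2 * 10 ^ 6) = 3 * 10 ^ 7 by norm_num]
      have h3 : 0 ≤ exp (-(t / (3 * 10 ^ 7))) := by positivity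
      nlinarith
  have hq64 := sq_one_add_le_exp (show 0 ≤ q / p by positivity)
  have hpow : ν.real A ^ (-(1 / (4 * p))) = exp (q / p / 4) := by
    rw [hAq, ← Real.exp_mul]; congr 1; field_simp
  have hss : s ^ 2 ≤ 504 ^ 2 * σ ^ 2 * (1 + q / p) ^ 2 := by
    have := pow_le_pow_left₀ hs0 hsle 2
    rwa [mul_pow, mul_pow] at this
  have hqp : 0 ≤ q / p := by positivity
  have h1q : 1 ≤ (1 + q / p) ^ 2 := one_le_pow₀ (by linarith)
  calc ∑ i, 12800 * β i ^ 2 * exp (-(t / (20 * β i)))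
      ≤ ∑ i, ((if i ∈ I then 12800 * b i else 0) +
        12800 * (9 / 4 * 10 ^ 12) * exp (-(t / (3 * 10 ^ 7)))) :=
        Finset.sum_le_sum fun i _ => hterm i
    _ = 12800 * ∑ i ∈ I, b i + 12800 * (9 / 4 * 10 ^ 12) * (n * exp (-(t / (3 * 10 ^ 7)))) := by
        rw [Finset.sum_add_distrib, Finset.sum_const, Finset.card_univ, Fintype.card_fin,
          nsmul_eq_mul, Finset.sum_ite_mem, Finset.univ_inter, Finset.mul_sum]
        ring
    _ ≤ 12800 * (2 * 10 ^ 12 * s ^ 2) + 12800 * (9 / 4 * 10 ^ 12) * σ ^ 2 := by gcongr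
    _ ≤ 12800 * (2 * 10 ^ 12 * (504 ^ 2 * σ ^ 2 * (1 + q / p) ^ 2)) +
        12800 * (9 / 4 * 10 ^ 12) * (σ ^ 2 * (1 + q / p) ^ 2) := by
        gcongr
        exact le_mul_of_one_le_right (by positivity) h1q
    _ ≤ 10 ^ 22 * σ ^ 2 * (1 + q / p) ^ 2 := by
        have : 0 ≤ σ ^ 2 * (1 + q / p) ^ 2 := by positivity
        linarith
    _ ≤ 10 ^ 22 * σ ^ 2 * (64 * exp (q / p / 4)) := by gcongr
    _ ≤ _ := by
        rw [hpow]
        have : 0 ≤ σ ^ 2 * exp (q / p / 4) := by positivity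
        linarith

/-- The weighted sum of square roots of the measures of the sections `A ∩ H` over all dyadic
half-spaces `H`. -/
theorem LogConcaveMeasure.tsum_inter_dyadicWeight_le (h : LogConcaveMeasure ν)
    (hiso : ∀ i, ∫ x, x i ^ 2 ∂ν = 1) {p σ t : ℝ} (hp : 1 ≤ p) (hσ : 0 < σ)
    (hmom : ∀ u : EuclideanSpace ℝ (Fin n), ‖u‖ = 1 → ∫ x, |⟪u, x⟫| ^ p ∂ν ≤ σ ^ p)
    (ht : 0 < t) (hnt : n * exp (-(t / (3 * 10 ^ 7))) ≤ σ ^ 2)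
    {A : Set (EuclideanSpace ℝ (Fin n))} (hA : MeasurableSet A) (hAc : Convex ℝ A) :
    ∑' j : Fin n × ℕ × Bool, dyadicWeight t j * ν (A ∩ dyadicHalfSpace t j) ^ (1 / 2 : ℝ) ≤
      ENNReal.ofReal (10 ^ 24 * σ ^ 2) * ν A ^ (1 / 2 - 1 / (4 * p)) := by
  have hp0 : 0 < p := by linarith
  rcases eq_or_ne (ν A) 0 with hA0 | hA0
  · have h1 : ∀ j : Fin n × ℕ × Bool, ν (A ∩ dyadicHalfSpace t j) = 0 := fun j =>
      measure_mono_null Set.inter_subset_left hA0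
    simp [h1]
  have h1 := h.tsum_cond_dyadicWeight_le hiso hp hσ hmom ht hnt hA hAc hA0
  have hAr : 0 < ν.real A := ENNReal.toReal_pos hA0 (measure_ne_top _ _)
  have h2 : ∀ j : Fin n × ℕ × Bool,
      dyadicWeight t j * ν (A ∩ dyadicHalfSpace t j) ^ (1 / 2 : ℝ) =
      dyadicWeight t j * (ν[|A]) (dyadicHalfSpace t j) ^ (1 / 2 : ℝ) * ν A ^ (1 / 2 : ℝ) := by
    intro j
    rw [← cond_mul_eq_inter hA, ENNReal.mul_rpow_of_nonneg _ _ (by norm_num), mul_assoc]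
  simp_rw [h2]
  rw [ENNReal.tsum_mul_right]
  calc _ ≤ ENNReal.ofReal (10 ^ 24 * σ ^ 2 * ν.real A ^ (-(1 / (4 * p)))) * ν A ^ (1 / 2 : ℝ) := by
        gcongr
    _ = _ := by
        rw [ENNReal.ofReal_mul (by positivity), ← ENNReal.ofReal_rpow_of_pos hAr,
          ofReal_measureReal, mul_assoc, ← ENNReal.rpow_add _ _ hA0 (measure_ne_top _ _)]
        congr 2
        ring

end ConditionalSums

section TruncatedSquares

variable {n : ℕ} {ν : Measure (EuclideanSpace ℝ (Fin n))} [IsProbabilityMeasure ν]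

/-- A weighted count of the dyadic half-spaces containing a point. -/
def dyadicCount (t : ℝ) (x : EuclideanSpace ℝ (Fin n)) : ℝ≥0∞ :=
  ∑' j : Fin n × ℕ × Bool, (dyadicHalfSpace t j).indicator (fun _ => dyadicWeight t j) x

theorem measurable_dyadicCount (t : ℝ) :
    Measurable (dyadicCount t : EuclideanSpace ℝ (Fin n) → ℝ≥0∞) :=
  Measurable.tsum fun j =>
    measurable_const.indicator (measurableSet_dyadicHalfSpace t j)

theorem sum_truncated_sq_le_dyadicCount {t : ℝ} (ht : 0 < t) (x : EuclideanSpace ℝ (Fin n)) :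
    ENNReal.ofReal (∑ i, if t ≤ |x i| then x i ^ 2 else 0) ≤ dyadicCount t x := by
  rw [dyadicCount, ENNReal.tsum_prod', tsum_fintype,
    ENNReal.ofReal_sum_of_nonneg (fun i _ => by split_ifs <;> positivity)]
  refine Finset.sum_le_sum fun i _ => ?_
  split_ifs with hi
  swap
  · simp
  obtain ⟨k, hk1, hk2⟩ := exists_nat_pow_near ((one_le_div ht).2 hi) one_lt_two
  rw [le_div_iff₀ ht] at hk1
  rw [div_lt_iff₀ ht] at hk2
  obtain ⟨b, hb⟩ : ∃ b : Bool, |x i| = (if b then 1 else -1) * x i := by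
    rcases abs_choice (x i) with h | h
    · exact ⟨true, by simp [h]⟩
    · exact ⟨false, by simp [h]⟩
  refine le_trans ?_ (ENNReal.le_tsum (k, b))
  have hmem : x ∈ dyadicHalfSpace t (i, k, b) := by
    rw [hb] at hk1
    exact hk1
  rw [Set.indicator_of_mem hmem, dyadicWeight]
  refine ENNReal.ofReal_le_ofReal ?_
  rw [← sq_abs]
  calc |x i| ^ 2 ≤ (2 ^ (k + 1) * t) ^ 2 := by gcongr
    _ = _ := by ring

theorem setLIntegral_dyadicCount_pow_succ (t : ℝ) {A : Set (EuclideanSpace ℝ (Fin n))} (l : ℕ) :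
    ∫⁻ x in A, dyadicCount t x ^ (l + 1) ∂ν =
      ∑' j, dyadicWeight t j * ∫⁻ x in A ∩ dyadicHalfSpace t j, dyadicCount t x ^ l ∂ν := by
  have hm := (measurable_dyadicCount (n := n) t).pow_const l
  have h1 : ∀ x : EuclideanSpace ℝ (Fin n), dyadicCount t x ^ (l + 1) =
      ∑' j, (dyadicHalfSpace t j).indicator
        (fun x => dyadicWeight t j * dyadicCount t x ^ l) x := by
    intro x
    rw [pow_succ', dyadicCount, ← ENNReal.tsum_mul_right]
    refine tsum_congr fun j => ?_
    by_cases hx : x ∈ dyadicHalfSpace t j <;> simp [hx, dyadicCount]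
  simp_rw [h1]
  rw [lintegral_tsum fun j =>
    ((hm.const_mul _).indicator (measurableSet_dyadicHalfSpace t j)).aemeasurable]
  refine tsum_congr fun j => ?_
  rw [lintegral_indicator (measurableSet_dyadicHalfSpace t j), lintegral_const_mul _ hm,
    Measure.restrict_restrict (measurableSet_dyadicHalfSpace t j), Set.inter_comm]

theorem LogConcaveMeasure.setLIntegral_dyadicCount_pow_le (h : LogConcaveMeasure ν)
    (hiso : ∀ i, ∫ x, x i ^ 2 ∂ν = 1) {p σ t : ℝ} (hp : 1 ≤ p) (hσ : 0 < σ)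
    (hmom : ∀ u : EuclideanSpace ℝ (Fin n), ‖u‖ = 1 → ∫ x, |⟪u, x⟫| ^ p ∂ν ≤ σ ^ p)
    (ht : 0 < t) (hnt : n * exp (-(t / (3 * 10 ^ 7))) ≤ σ ^ 2)
    (l : ℕ) (hl : l ≤ 2 * p) {A : Set (EuclideanSpace ℝ (Fin n))} (hA : MeasurableSet A)
    (hAc : Convex ℝ A) :
    ∫⁻ x in A, dyadicCount t x ^ l ∂ν ≤
      ENNReal.ofReal (10 ^ 24 * σ ^ 2) ^ l * ν A ^ (1 - l / (4 * p)) := by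
  have hp0 : 0 < p := by linarith
  induction l generalizing A with
  | zero => simp
  | succ l ih =>
    have hl' : (l : ℝ) ≤ 2 * p := by push_cast at hl; linarith
    have he : 0 ≤ 1 / 2 - l / (4 * p) := by
      rw [sub_nonneg, div_le_div_iff₀ (by positivity) (by norm_num)]
      linarith
    have he' : 0 ≤ 1 / 2 - 1 / (4 * p) := by
      rw [sub_nonneg, div_le_div_iff₀ (by positivity) (by norm_num)]
      linarith
    set κ := ENNReal.ofReal (10 ^ 24 * σ ^ 2)
    rw [setLIntegral_dyadicCount_pow_succ]
    calc ∑' j, dyadicWeight t j * ∫⁻ x in A ∩ dyadicHalfSpace t j, dyadicCount t x ^ l ∂ν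
        ≤ ∑' j, κ ^ l * ν A ^ (1 / 2 - l / (4 * p)) *
          (dyadicWeight t j * ν (A ∩ dyadicHalfSpace t j) ^ (1 / 2 : ℝ)) := by
          refine ENNReal.tsum_le_tsum fun j => ?_
          have h1 := ih hl' (hA.inter (measurableSet_dyadicHalfSpace t j))
            (hAc.inter (convex_dyadicHalfSpace t j))
          have h2 : ν (A ∩ dyadicHalfSpace t j) ^ (1 - l / (4 * p)) ≤
              ν (A ∩ dyadicHalfSpace t j) ^ (1 / 2 : ℝ) * ν A ^ (1 / 2 - l / (4 * p)) := by
            rw [show 1 - l / (4 * p) = 1 / 2 + (1 / 2 - l / (4 * p)) by ring,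
              ENNReal.rpow_add_of_nonneg _ _ (by norm_num) he]
            gcongr
            exact Set.inter_subset_left
          calc _ ≤ dyadicWeight t j * (κ ^ l * (ν (A ∩ dyadicHalfSpace t j) ^ (1 / 2 : ℝ) *
              ν A ^ (1 / 2 - l / (4 * p)))) := by
                gcongr
                exact h1.trans (by gcongr)
            _ = _ := by ring
      _ ≤ κ ^ l * ν A ^ (1 / 2 - l / (4 * p)) * (κ * ν A ^ (1 / 2 - 1 / (4 * p))) := by
          rw [ENNReal.tsum_mul_left]
          gcongr
          exact h.tsum_inter_dyadicWeight_le hiso hp hσ hmom ht hnt hA hAc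
      _ = κ ^ (l + 1) * (ν A ^ (1 / 2 - l / (4 * p)) * ν A ^ (1 / 2 - 1 / (4 * p))) := by ring
      _ = _ := by
          rw [← ENNReal.rpow_add_of_nonneg _ _ he he']
          congr 2
          push_cast
          ring

/-- Lyapunov's inequality: a bound on a higher moment controls the lower ones. -/
theorem lintegral_rpow_le_of_lintegral_pow_le {α : Type*} [MeasurableSpace α] {m : Measure α}
    [IsProbabilityMeasure m] {f : α → ℝ≥0∞} (hf : Measurable f) {p : ℝ} (hp : 0 < p) {l : ℕ}
    (hpl : p ≤ l) {c : ℝ≥0∞} (hc : ∫⁻ x, f x ^ l ∂m ≤ c ^ l) :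
    ∫⁻ x, f x ^ p ∂m ≤ c ^ p := by
  have hl : (0 : ℝ) < l := hp.trans_le hpl
  have h1 := eLpNorm'_le_eLpNorm'_of_exponent_le (μ := m) hp hpl hf.aestronglyMeasurable
  simp only [eLpNorm', enorm_eq_self] at h1
  have h2 : (∫⁻ x, f x ^ (l : ℝ) ∂m) ^ (1 / (l : ℝ)) ≤ c := by
    simp_rw [ENNReal.rpow_natCast]
    calc _ ≤ (c ^ l) ^ (1 / (l : ℝ)) := by gcongr
      _ = c := by
        rw [← ENNReal.rpow_natCast, ← ENNReal.rpow_mul, mul_one_div_cancel hl.ne',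
          ENNReal.rpow_one]
  calc ∫⁻ x, f x ^ p ∂m = ((∫⁻ x, f x ^ p ∂m) ^ (1 / p)) ^ p := by
        rw [← ENNReal.rpow_mul, one_div_mul_cancel hp.ne', ENNReal.rpow_one]
    _ ≤ c ^ p := by
        gcongr
        exact h1.trans h2

theorem natCeil_le_two_mul {p : ℝ} (hp : 1 ≤ p) : (⌈p⌉₊ : ℝ) ≤ 2 * p := by
  have := Nat.ceil_lt_add_one (show 0 ≤ p by linarith)
  linarith

theorem integral_rpow_le_of_lintegral_rpow_le {α : Type*} [MeasurableSpace α] {m : Measure α}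
    {f : α → ℝ} (hf : Measurable f) (hf0 : ∀ x, 0 ≤ f x) {p c : ℝ} (hp : 0 ≤ p) (hc : 0 ≤ c)
    (h : ∫⁻ x, ENNReal.ofReal (f x) ^ p ∂m ≤ ENNReal.ofReal c ^ p) :
    ∫ x, f x ^ p ∂m ≤ c ^ p := by
  rw [integral_eq_lintegral_of_nonneg_ae (Filter.Eventually.of_forall fun x =>
    Real.rpow_nonneg (hf0 x) p) (hf.pow_const p).aestronglyMeasurable]
  refine ENNReal.toReal_le_of_le_ofReal (Real.rpow_nonneg hc p) ?_
  rw [← ENNReal.ofReal_rpow_of_nonneg hc hp]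
  refine le_trans (le_of_eq ?_) h
  refine lintegral_congr fun x => ?_
  rw [ENNReal.ofReal_rpow_of_nonneg (hf0 x) hp]

theorem measurable_sum_truncated_sq (t : ℝ) :
    Measurable fun x : EuclideanSpace ℝ (Fin n) => ∑ i, if t ≤ |x i| then x i ^ 2 else 0 := by
  have hx : ∀ i, Measurable fun x : EuclideanSpace ℝ (Fin n) => x i := fun i => by fun_prop
  exact Finset.measurable_sum _ fun i _ =>
    Measurable.ite (measurableSet_le measurable_const (hx i).abs) ((hx i).pow_const 2)
      measurable_const

theorem LogConcaveMeasure.integral_sum_truncated_sq_le (h : LogConcaveMeasure ν)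
    (hiso : ∀ i, ∫ x, x i ^ 2 ∂ν = 1) {p σ t : ℝ} (hp : 1 ≤ p) (hσ : 0 < σ)
    (hmom : ∀ u : EuclideanSpace ℝ (Fin n), ‖u‖ = 1 → ∫ x, |⟪u, x⟫| ^ p ∂ν ≤ σ ^ p)
    (ht : 0 < t) (hnt : n * exp (-(t / (3 * 10 ^ 7))) ≤ σ ^ 2) :
    ∫ x, (∑ i, if t ≤ |x i| then x i ^ 2 else 0) ^ p ∂ν ≤ (10 ^ 24 * σ ^ 2) ^ p := by
  have hp0 : 0 < p := by linarith
  refine integral_rpow_le_of_lintegral_rpow_le (measurable_sum_truncated_sq t)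
    (fun x => Finset.sum_nonneg fun i _ => by split_ifs <;> positivity) hp0.le (by positivity) ?_
  refine le_trans (lintegral_mono fun x => ?_) (lintegral_rpow_le_of_lintegral_pow_le
    (measurable_dyadicCount t) hp0 (Nat.le_ceil p) ?_)
  · exact ENNReal.rpow_le_rpow (sum_truncated_sq_le_dyadicCount ht x) hp0.le
  · simpa using h.setLIntegral_dyadicCount_pow_le hiso hp hσ hmom ht hnt ⌈p⌉₊
      (natCeil_le_two_mul hp) MeasurableSet.univ convex_univ

theorem LogConcaveMeasure.integral_sum_sq_rpow_le (h : LogConcaveMeasure ν)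
    (hiso : ∀ i, ∫ x, x i ^ 2 ∂ν = 1) (hn : 0 < n) {p σ : ℝ} (hp : 1 ≤ p) (hσ : 0 < σ)
    (hmom : ∀ u : EuclideanSpace ℝ (Fin n), ‖u‖ = 1 → ∫ x, |⟪u, x⟫| ^ p ∂ν ≤ σ ^ p)
    (hnσ : n ≤ σ ^ 2) :
    ∫ x, (∑ i, x i ^ 2) ^ p ∂ν ≤ (10 ^ 24 * σ ^ 2) ^ p := by
  have hp0 : 0 < p := by linarith
  have hl : p ≤ ⌈p⌉₊ := Nat.le_ceil p
  have hl1 : 1 ≤ ⌈p⌉₊ := Nat.one_le_ceil_iff.2 hp0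
  have hm : Measurable fun x : EuclideanSpace ℝ (Fin n) => ∑ i, x i ^ 2 :=
    Finset.measurable_sum _ fun i _ => by fun_prop
  have : Nonempty (Fin n) := ⟨⟨0, hn⟩⟩
  refine integral_rpow_le_of_lintegral_rpow_le hm
    (fun x => Finset.sum_nonneg fun i _ => sq_nonneg _) hp0.le (by positivity) ?_
  refine lintegral_rpow_le_of_lintegral_pow_le hm.ennreal_ofReal hp0 hl ?_
  have h1 := h.integral_sum_sq_pow_le hiso hp hσ hmom
    (Finset.univ_nonempty (α := Fin n)) hl1 hl
  have hr : 252 * σ * ⌈p⌉₊ / p ≤ 504 * σ := by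
    rw [div_le_iff₀ hp0]
    nlinarith [natCeil_le_two_mul hp]
  have hsq : √(n : ℝ) ≤ σ := Real.sqrt_le_iff.2 ⟨hσ.le, hnσ⟩
  have hint : Integrable (fun x => (∑ i, x i ^ 2) ^ ⌈p⌉₊) ν := by
    have := h.integrable_norm_pow (m := 2 * ⌈p⌉₊) (by omega)
    simpa only [pow_mul, EuclideanSpace.norm_sq_eq, Real.norm_eq_abs, sq_abs] using this
  simp_rw [← ENNReal.ofReal_pow (Finset.sum_nonneg fun i _ => sq_nonneg _)]
  rw [← ofReal_integral_eq_lintegral_ofReal hint (Filter.Eventually.of_forall fun x => by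
    positivity), ← ENNReal.ofReal_pow (by positivity)]
  refine ENNReal.ofReal_le_ofReal (h1.trans ?_)
  rw [Finset.card_univ, Fintype.card_fin]
  refine pow_le_pow_left₀ (by positivity) ?_ _
  calc (400000 * (√(n : ℝ) + 252 * σ * ⌈p⌉₊ / p)) ^ 2 ≤ (400000 * (σ + 504 * σ)) ^ 2 := by gcongr
    _ ≤ 10 ^ 24 * σ ^ 2 := by
        have := sq_nonneg σ
        nlinarith

end TruncatedSquares

section DirectionalMoments

variable {n : ℕ} {μ : Measure Ω} [IsProbabilityMeasure μ] {X : Ω → EuclideanSpace ℝ (Fin n)}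

theorem IsLogConcave.bddAbove_moments (hX : Measurable X) (hlc : IsLogConcave μ X) {p : ℝ}
    (hp : 1 ≤ p) :
    BddAbove (Set.range fun t : {t : EuclideanSpace ℝ (Fin n) // ‖t‖ = 1} =>
      (∫ ω, |⟪t.1, X ω⟫| ^ p ∂μ) ^ (1 / p)) := by
  have hp0 : 0 < p := by linarith
  have : IsProbabilityMeasure (μ.map X) := Measure.isProbabilityMeasure_map hX.aemeasurable
  have h := hlc.logConcaveMeasure_map hX
  have hl1 : 1 ≤ ⌈p⌉₊ := Nat.one_le_ceil_iff.2 hp0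
  refine ⟨(∫ ω, (1 + ‖X ω‖ ^ ⌈p⌉₊) ∂μ) ^ (1 / p), ?_⟩
  rintro _ ⟨⟨u, hu⟩, rfl⟩
  have hint : Integrable (fun ω => ‖X ω‖ ^ ⌈p⌉₊) μ :=
    (h.integrable_norm_pow hl1).comp_measurable hX
  refine Real.rpow_le_rpow (integral_nonneg fun _ => by positivity) ?_ (by positivity)
  refine integral_mono_of_nonneg (Filter.Eventually.of_forall fun _ => by positivity)
    ((integrable_const 1).add hint) (Filter.Eventually.of_forall fun ω => ?_)
  have h1 : |⟪u, X ω⟫| ≤ ‖X ω‖ := by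
    simpa [hu] using abs_real_inner_le_norm u (X ω)
  change |⟪u, X ω⟫| ^ p ≤ 1 + ‖X ω‖ ^ ⌈p⌉₊
  rcases le_total ‖X ω‖ 1 with h2 | h2
  · have := Real.rpow_le_one (abs_nonneg _) (h1.trans h2) hp0.le
    have : 0 ≤ ‖X ω‖ ^ ⌈p⌉₊ := by positivity
    linarith
  · calc |⟪u, X ω⟫| ^ p ≤ ‖X ω‖ ^ p := by gcongr
      _ ≤ ‖X ω‖ ^ (⌈p⌉₊ : ℝ) := Real.rpow_le_rpow_of_exponent_le h2 (Nat.le_ceil p)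
      _ ≤ _ := by rw [Real.rpow_natCast]; linarith

theorem sigmaX_nonneg (p : ℝ) : 0 ≤ sigmaX μ X p :=
  Real.iSup_nonneg fun _ => Real.rpow_nonneg (integral_nonneg fun _ => by positivity) _

theorem IsLogConcave.integral_inner_rpow_le_sigmaX (hX : Measurable X) (hlc : IsLogConcave μ X)
    {p : ℝ} (hp : 1 ≤ p) {u : EuclideanSpace ℝ (Fin n)} (hu : ‖u‖ = 1) :
    ∫ ω, |⟪u, X ω⟫| ^ p ∂μ ≤ sigmaX μ X p ^ p := by
  have hp0 : 0 < p := by linarith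
  have h0 : 0 ≤ ∫ ω, |⟪u, X ω⟫| ^ p ∂μ := integral_nonneg fun _ => by positivity
  have h1 : (∫ ω, |⟪u, X ω⟫| ^ p ∂μ) ^ (1 / p) ≤ sigmaX μ X p :=
    le_ciSup (hlc.bddAbove_moments hX hp) ⟨u, hu⟩
  calc ∫ ω, |⟪u, X ω⟫| ^ p ∂μ = ((∫ ω, |⟪u, X ω⟫| ^ p ∂μ) ^ (1 / p)) ^ p := by
        rw [← Real.rpow_mul h0, one_div_mul_cancel hp0.ne', Real.rpow_one]
    _ ≤ _ := by gcongr

theorem IsLogConcave.sigmaX_pos (hX : Measurable X) (hlc : IsLogConcave μ X)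
    (hiso : IsIsotropic μ X) (hn : 0 < n) {p : ℝ} (hp : 1 ≤ p) : 0 < sigmaX μ X p := by
  have hp0 : 0 < p := by linarith
  have : IsProbabilityMeasure (μ.map X) := Measure.isProbabilityMeasure_map hX.aemeasurable
  have h := hlc.logConcaveMeasure_map hX
  refine (sigmaX_nonneg p).lt_of_ne fun h0 => ?_
  set u : EuclideanSpace ℝ (Fin n) := EuclideanSpace.single ⟨0, hn⟩ 1
  have hu : ‖u‖ = 1 := by simp [u]
  have h1 := hlc.integral_inner_rpow_le_sigmaX hX hp hu
  rw [← h0, Real.zero_rpow hp0.ne'] at h1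
  have hint : Integrable (fun ω => |⟪u, X ω⟫| ^ p) μ :=
    (h.integrable_rpow (innerSL ℝ u) hp).comp_measurable hX
  have h2 := (integral_eq_zero_iff_of_nonneg (fun ω => by positivity) hint).1
    (h1.antisymm (integral_nonneg fun ω => by positivity))
  have h3 : ∫ ω, X ω ⟨0, hn⟩ * X ω ⟨0, hn⟩ ∂μ = 0 := by
    refine integral_eq_zero_of_ae ?_
    filter_upwards [h2] with ω hω
    have h4 : |⟪u, X ω⟫| ^ p = 0 := hω
    rw [Real.rpow_eq_zero (abs_nonneg _) hp0.ne', abs_eq_zero] at h4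
    have h5 : X ω ⟨0, hn⟩ = 0 := by simpa [u, EuclideanSpace.inner_single_left] using h4
    simp [h5]
  simp [hiso.2] at h3

end DirectionalMoments

/-- **Theorem 1 (modified Paouris inequality).** There is a universal constant `C > 0` such that
for every isotropic log-concave random vector `X` in `ℝⁿ`, every `p ≥ 1` and every
`t ≥ C·log(n/σ_X(p)²)`, one has `E[(∑ᵢ Xᵢ² 𝟙{|Xᵢ| ≥ t})^p] ≤ (C·σ_X(p))^(2p)`. -/
theorem cut_paouris :
    ∃ C : ℝ, 0 < C ∧
      ∀ (Ω : Type) (_ : MeasurableSpace Ω) (μ : Measure Ω), IsProbabilityMeasure μ →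
      ∀ (n : ℕ) (X : Ω → EuclideanSpace ℝ (Fin n)), Measurable X →
      IsLogConcave μ X → IsIsotropic μ X →
      ∀ p : ℝ, 1 ≤ p →
      ∀ t : ℝ, C * Real.log ((n : ℝ) / (sigmaX μ X p) ^ 2) ≤ t →
        ∫ ω, (∑ i, if t ≤ |X ω i| then (X ω i) ^ 2 else 0) ^ p ∂μ ≤
          (C * sigmaX μ X p) ^ (2 * p) := by
  refine ⟨10 ^ 12, by norm_num, ?_⟩
  intro Ω _ μ _ n X hX hlc hiso p hp t ht
  have hp0 : 0 < p := by linarith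
  rcases n.eq_zero_or_pos with rfl | hn
  · have := sigmaX_nonneg (μ := μ) (X := X) p
    simp only [Finset.univ_eq_empty, Finset.sum_empty, Real.zero_rpow hp0.ne', integral_zero]
    positivity
  have hσ := hlc.sigmaX_pos hX hiso hn hp
  have hmomX := fun u (hu : ‖u‖ = 1) => hlc.integral_inner_rpow_le_sigmaX hX hp hu
  set σ := sigmaX μ X p
  have h := hlc.logConcaveMeasure_map hX
  set ν := μ.map X with hν
  have : IsProbabilityMeasure ν := Measure.isProbabilityMeasure_map hX.aemeasurable
  have hisoν : ∀ i, ∫ x, x i ^ 2 ∂ν = 1 := by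
    intro i
    rw [integral_map hX.aemeasurable (by fun_prop)]
    simpa [pow_two] using hiso.2 i i
  have hmom : ∀ u : EuclideanSpace ℝ (Fin n), ‖u‖ = 1 → ∫ x, |⟪u, x⟫| ^ p ∂ν ≤ σ ^ p := by
    intro u hu
    have hm : Measurable fun x : EuclideanSpace ℝ (Fin n) => |⟪u, x⟫| ^ p := by
      have : Measurable fun x : EuclideanSpace ℝ (Fin n) => ⟪u, x⟫ := by fun_prop
      exact this.abs.pow_const p
    rw [integral_map hX.aemeasurable hm.aestronglyMeasurable]
    exact hmomX u hu
  have hn0 : (0 : ℝ) < n := by exact_mod_cast hn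
  have hRHS : ((10 : ℝ) ^ 12 * σ) ^ (2 * p) = (10 ^ 24 * σ ^ 2) ^ p := by
    rw [Real.rpow_mul (by positivity), Real.rpow_two, mul_pow]
    norm_num
  rw [hRHS, ← integral_map hX.aemeasurable
    (f := fun x : EuclideanSpace ℝ (Fin n) => (∑ i, if t ≤ |x i| then x i ^ 2 else 0) ^ p)
    ((measurable_sum_truncated_sq t).pow_const p).aestronglyMeasurable]
  rcases le_or_gt t 0 with ht0 | ht0
  · have hnσ : (n : ℝ) ≤ σ ^ 2 := by
      by_contra! hcon
      have := Real.log_pos ((one_lt_div (by positivity)).2 hcon)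
      nlinarith
    have h1 : ∀ (x : EuclideanSpace ℝ (Fin n)) i, t ≤ |x i| := fun x i => ht0.trans (abs_nonneg _)
    simpa only [h1, if_true] using h.integral_sum_sq_rpow_le hisoν hn hp hσ hmom hnσ
  · refine h.integral_sum_truncated_sq_le hisoν hp hσ hmom ht0 ?_
    have h1 : Real.log (n / σ ^ 2) ≤ t / (3 * 10 ^ 7) := by
      rcases le_total (Real.log (n / σ ^ 2)) 0 with h0 | h0
      · exact h0.trans (by positivity)
      · rw [le_div_iff₀ (by norm_num)]
        nlinarith
    rw [Real.log_le_iff_le_exp (by positivity), div_le_iff₀ (by positivity)] at h1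
    rw [Real.exp_neg, ← div_eq_mul_inv, div_le_iff₀ (exp_pos _)]
    linarith

end
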